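/- No integer k with 30 < k ≤ 10^11 is a P-integer. -/

import Mathlib

open scoped BigOperators

/-- Number of primes not exceeding the real number `x` (so `primePi x = 0` for `x ≤ 1`). -/
noncomputable def primePi (x : ℝ) : ℕ :=
  ((Finset.range (⌊x⌋₊ + 1)).filter Nat.Prime).card

/-- The `n`-th prime, with `nthPrime 1 = 2`, `nthPrime 2 = 3`, etc. -/
noncomputable def nthPrime (n : ℕ) : ℕ := Nat.nth Nat.Prime (n - 1)
/-- The `i`-th (0-indexed) prime not dividing `k`, in increasing order. -/
noncomputable def nthPrimeNotDvd (k i : ℕ) : ℕ := Nat.nth (fun p => p.Prime ∧ ¬ p ∣ k) i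

/-- `k` is a `P`-integer: `k > 1` and the first `φ(k)` primes not dividing `k` are pairwise
incongruent modulo `k` and their residues are exactly the residues coprime to `k`. -/
def IsPInteger (k : ℕ) : Prop :=
  1 < k ∧
  Set.InjOn (fun i => nthPrimeNotDvd k i % k) (Set.Iio k.totient) ∧
  (fun i => nthPrimeNotDvd k i % k) '' Set.Iio k.totient = {r | r < k ∧ Nat.Coprime r k}

/-- The consequences of `IsPInteger` used in the sequel, transferred to an even modulus `m`;
`T` is the largest of the first `φ(k)` primes not dividing `k`. -/
structure Saturated (m T : ℕ) : Prop where
  even : 2 ∣ m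
  cover : ∀ r < m, r.Coprime m → r ≠ m / 2 + 2 → ∃ p, p.Prime ∧ p ≤ T ∧ p % m = r
  inj : ∀ p p' : ℕ, p.Prime → p'.Prime → p ≤ T → p' ≤ T → ¬ p ∣ m → ¬ p' ∣ m →
    p % m = p' % m → p = p'
  bound : ∀ x, m.totient + m.primeFactors.card ≤ Nat.primeCounting x → T ≤ x

lemma infinite_setOf_prime_not_dvd {k : ℕ} (hk : k ≠ 0) :
    {p : ℕ | p.Prime ∧ ¬ p ∣ k}.Infinite := by
  refine (Nat.infinite_setOfPred_prime.sdiff k.primeFactors.finite_toSet).mono ?_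
  rintro p ⟨hp, hpk⟩
  refine ⟨hp, fun h => hpk ?_⟩
  simpa [hk] using ⟨hp, h⟩

lemma primeCounting_le_count_add_card (k x : ℕ) (hk : k ≠ 0) :
    Nat.primeCounting x ≤
      Nat.count (fun p => p.Prime ∧ ¬ p ∣ k) (x + 1) + k.primeFactors.card := by
  rw [Nat.primeCounting, Nat.primeCounting', Nat.count_eq_card_filter_range,
    Nat.count_eq_card_filter_range]
  refine le_trans (Finset.card_le_card ?_) (Finset.card_union_le _ _)
  intro p hp
  simp only [Finset.mem_filter, Finset.mem_union, Nat.mem_primeFactors] at hp ⊢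
  by_cases h : p ∣ k
  · exact Or.inr ⟨hp.2, h, hk⟩
  · exact Or.inl ⟨hp.1, hp.2, h⟩

lemma nthPrimeNotDvd_bound {k m x : ℕ} (hk : k ≠ 0) (hm : m ≠ 0) (hkm : k ∣ m)
    (hx : k.totient + m.primeFactors.card ≤ Nat.primeCounting x) :
    nthPrimeNotDvd k (k.totient - 1) ≤ x := by
  have h1 := primeCounting_le_count_add_card k x hk
  have h2 := Finset.card_le_card (Nat.primeFactors_mono hkm hm)
  have h3 : 0 < k.totient := Nat.totient_pos.2 (Nat.pos_of_ne_zero hk)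
  have h4 : k.totient - 1 < Nat.count (fun p => p.Prime ∧ ¬ p ∣ k) (x + 1) := by omega
  exact Nat.lt_succ_iff.1 (Nat.nth_lt_of_lt_count h4)

lemma exists_nthPrimeNotDvd_eq {k p : ℕ} (hk : k ≠ 0) (hp : p.Prime) (hpk : ¬ p ∣ k)
    (hle : p ≤ nthPrimeNotDvd k (k.totient - 1)) :
    ∃ i < k.totient, nthPrimeNotDvd k i = p := by
  have h3 : 0 < k.totient := Nat.totient_pos.2 (Nat.pos_of_ne_zero hk)
  refine ⟨Nat.count (fun p => p.Prime ∧ ¬ p ∣ k) p, ?_, ?_⟩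
  · have : Nat.count (fun p => p.Prime ∧ ¬ p ∣ k) p ≤ k.totient - 1 := by
      by_contra! h
      have := (Nat.nth_strictMono (infinite_setOf_prime_not_dvd hk)) h
      rw [Nat.nth_count (show p.Prime ∧ ¬ p ∣ k from ⟨hp, hpk⟩)] at this
      exact absurd hle (not_le.2 this)
    omega
  · exact Nat.nth_count (show p.Prime ∧ ¬ p ∣ k from ⟨hp, hpk⟩)

lemma IsPInteger.exists_prime {k r : ℕ} (hk : IsPInteger k) (hr : r < k) (hc : r.Coprime k) :
    ∃ p, p.Prime ∧ p ≤ nthPrimeNotDvd k (k.totient - 1) ∧ p % k = r := by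
  have h0 : k ≠ 0 := by have := hk.1; omega
  have : r ∈ (fun i => nthPrimeNotDvd k i % k) '' Set.Iio k.totient := by
    rw [hk.2.2]; exact ⟨hr, hc⟩
  obtain ⟨i, hi, rfl⟩ := this
  refine ⟨_, (Nat.nth_mem_of_infinite (infinite_setOf_prime_not_dvd h0) i).1, ?_, rfl⟩
  have hi : i < k.totient := hi
  exact (Nat.nth_strictMono (infinite_setOf_prime_not_dvd h0)).monotone (by omega)

lemma IsPInteger.eq_of_mod_eq {k p p' : ℕ} (hk : IsPInteger k) (hp : p.Prime) (hp' : p'.Prime)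
    (hT : p ≤ nthPrimeNotDvd k (k.totient - 1)) (hT' : p' ≤ nthPrimeNotDvd k (k.totient - 1))
    (hd : ¬ p ∣ k) (hd' : ¬ p' ∣ k) (h : p % k = p' % k) : p = p' := by
  have h0 : k ≠ 0 := by have := hk.1; omega
  obtain ⟨i, hi, rfl⟩ := exists_nthPrimeNotDvd_eq h0 hp hd hT
  obtain ⟨j, hj, rfl⟩ := exists_nthPrimeNotDvd_eq h0 hp' hd' hT'
  rw [hk.2.1 hi hj h]

lemma IsPInteger.saturated_of_even {k : ℕ} (hk : IsPInteger k) (h2 : 2 ∣ k) :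
    Saturated k (nthPrimeNotDvd k (k.totient - 1)) where
  even := h2
  cover r hr hc _ := hk.exists_prime hr hc
  inj p p' hp hp' hT hT' hd hd' h := hk.eq_of_mod_eq hp hp' hT hT' hd hd' h
  bound x hx := by
    have h0 : k ≠ 0 := by have := hk.1; omega
    exact nthPrimeNotDvd_bound h0 h0 dvd_rfl hx

lemma IsPInteger.saturated_of_odd {k : ℕ} (hk : IsPInteger k) (h2 : ¬ 2 ∣ k) :
    Saturated (2 * k) (nthPrimeNotDvd k (k.totient - 1)) where
  even := dvd_mul_right 2 k
  cover r hr hc hne := by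
    have h0 : 1 < k := hk.1
    have hodd : r % 2 = 1 := by
      rcases Nat.mod_two_eq_zero_or_one r with h | h
      · have := Nat.dvd_gcd (Nat.dvd_of_mod_eq_zero h) (dvd_mul_right 2 k)
        rw [hc] at this
        omega
      · exact h
    have hck : (r % k).Coprime k := by
      have := Nat.Coprime.coprime_mul_left_right hc
      exact (Nat.ModEq.gcd_eq (Nat.mod_modEq r k)).trans this
    obtain ⟨p, hp, hpT, hpr⟩ := hk.exists_prime (Nat.mod_lt r (by omega)) hck
    refine ⟨p, hp, hpT, ?_⟩
    have hcop : Nat.Coprime 2 k := (Nat.Prime.coprime_iff_not_dvd Nat.prime_two).2 h2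
    rcases hp.eq_two_or_odd with rfl | hpo
    · exfalso
      have hk2 : 2 < k := by
        rcases Nat.lt_or_ge 2 k with h | h
        · exact h
        · exact absurd (show 2 ∣ k by have : k = 2 := by omega
                                      rw [this]) h2
      rw [Nat.mod_eq_of_lt hk2] at hpr
      rcases Nat.lt_or_ge r k with h | h
      · rw [Nat.mod_eq_of_lt h] at hpr; omega
      · rw [Nat.mod_eq_sub_mod h, Nat.mod_eq_of_lt (by omega)] at hpr
        omega
    · have h1 : p ≡ r [MOD 2] := by rw [Nat.ModEq, hpo, hodd]
      have := (Nat.modEq_and_modEq_iff_modEq_mul hcop).1 ⟨h1, hpr⟩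
      rw [this, Nat.mod_eq_of_lt hr]
  inj p p' hp hp' hT hT' hd hd' h := by
    refine hk.eq_of_mod_eq hp hp' hT hT' (fun h => hd (h.mul_left 2))
      (fun h => hd' (h.mul_left 2)) ?_
    exact Nat.ModEq.of_mul_left 2 h
  bound x hx := by
    have h0 : k ≠ 0 := by have := hk.1; omega
    have hcop : Nat.Coprime 2 k := (Nat.Prime.coprime_iff_not_dvd Nat.prime_two).2 h2
    rw [Nat.totient_mul hcop, Nat.totient_two, one_mul] at hx
    exact nthPrimeNotDvd_bound h0 (by omega) (dvd_mul_left k 2) hx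

lemma log_factorial_eq_sum (n : ℕ) :
    Real.log n.factorial =
      ∑ d ∈ Finset.Ioc 0 n, ArithmeticFunction.vonMangoldt d * ((n / d : ℕ) : ℝ) := by
  rw [← ArithmeticFunction.sum_Ioc_mul_zeta_eq_sum,
    ArithmeticFunction.vonMangoldt_mul_zeta]
  induction n with
  | zero => simp
  | succ n ih =>
    rw [Nat.factorial_succ, Nat.cast_mul, Real.log_mul (by positivity) (by positivity), ih,
      Finset.sum_Ioc_succ_top (Nat.zero_le n), add_comm]
    simp

lemma log_factorial_div_eq_sum (n k : ℕ) :
    Real.log (n / k).factorial =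
      ∑ d ∈ Finset.Ioc 0 n, ArithmeticFunction.vonMangoldt d * ((n / k / d : ℕ) : ℝ) := by
  rw [log_factorial_eq_sum]
  refine Finset.sum_subset (Finset.Ioc_subset_Ioc_right (Nat.div_le_self n k)) fun d hd hd' => ?_
  have h : n / k < d := by
    simp only [Finset.mem_Ioc] at hd hd'
    omega
  simp [Nat.div_eq_of_lt h]

/-- Chebyshev's inequality. -/
lemma log_factorial_combination_le_psi (n : ℕ) :
    Real.log n.factorial + Real.log (n / 30).factorial - Real.log (n / 2).factorial -
      Real.log (n / 3).factorial - Real.log (n / 5).factorial ≤ Chebyshev.psi n := by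
  rw [log_factorial_eq_sum, log_factorial_div_eq_sum n 30, log_factorial_div_eq_sum n 2,
    log_factorial_div_eq_sum n 3, log_factorial_div_eq_sum n 5, Chebyshev.psi, Nat.floor_natCast,
    ← Finset.sum_add_distrib, ← Finset.sum_sub_distrib, ← Finset.sum_sub_distrib,
    ← Finset.sum_sub_distrib]
  refine Finset.sum_le_sum fun d _ => ?_
  have h0 : 0 ≤ ArithmeticFunction.vonMangoldt d := ArithmeticFunction.vonMangoldt_nonneg
  have h1 : n / d + n / 30 / d ≤ n / 2 / d + n / 3 / d + n / 5 / d + 1 := by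
    have e : ∀ k, n / k / d = n / d / k := fun k => by
      rw [Nat.div_div_eq_div_mul, Nat.div_div_eq_div_mul, mul_comm]
    rw [e, e, e, e]
    omega
  have h2 : ((n / d : ℕ) : ℝ) + (n / 30 / d : ℕ) ≤
      (n / 2 / d : ℕ) + (n / 3 / d : ℕ) + (n / 5 / d : ℕ) + 1 := by exact_mod_cast h1
  nlinarith

lemma mul_log_sub_le_log_factorial {n : ℕ} (hn : n ≠ 0) :
    n * Real.log n - n ≤ Real.log n.factorial := by
  have h := Stirling.le_log_factorial_stirling hn
  have h1 : (0 : ℝ) ≤ Real.log n := Real.log_natCast_nonneg n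
  have h2 : (0 : ℝ) ≤ Real.log (2 * Real.pi) :=
    Real.log_nonneg (by linarith [Real.pi_gt_three])
  linarith

lemma log_factorial_le {n : ℕ} (hn : 1 ≤ n) :
    Real.log n.factorial ≤ (n + 1) * Real.log n - n + 1 := by
  induction n, hn using Nat.le_induction with
  | base => simp
  | succ n hn ih =>
    have hn0 : (0 : ℝ) < n := by exact_mod_cast hn
    rw [Nat.factorial_succ, Nat.cast_mul, Real.log_mul (by positivity) (by positivity)]
    have h := Real.log_le_sub_one_of_pos (show (0 : ℝ) < n / (n + 1) by positivity)
    rw [Real.log_div (by positivity) (by positivity)] at h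
    have h' : (n + 1 : ℝ) * (Real.log n - Real.log (n + 1)) ≤ (n + 1) * (n / (n + 1) - 1) :=
      mul_le_mul_of_nonneg_left h (by positivity)
    have e : (n + 1 : ℝ) * (n / (n + 1) - 1) = -1 := by field_simp; ring
    push_cast
    nlinarith

lemma cast_div_lt_add_one (n k : ℕ) : (n / k : ℝ) < (n / k : ℕ) + 1 := by
  rw [← Nat.floor_div_eq_div (K := ℝ)]
  exact Nat.lt_floor_add_one _

lemma log_factorial_div_le {n k : ℕ} (hk : 1 ≤ k) (hn : 3 * k ≤ n) :
    Real.log (n / k).factorial ≤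
      (n / k : ℝ) * (Real.log n - Real.log k - 1) + Real.log n + 1 := by
  have hk0 : (0 : ℝ) < k := by exact_mod_cast hk
  have hn0 : (0 : ℝ) < n := by exact_mod_cast (by omega : 0 < n)
  have h3 : 3 ≤ n / k := (Nat.le_div_iff_mul_le hk).2 hn
  have hle : ((n / k : ℕ) : ℝ) ≤ n / k := Nat.cast_div_le
  have h3' : (3 : ℝ) ≤ (n / k : ℕ) := by exact_mod_cast h3
  have hlog : Real.log (n / k : ℕ) ≤ Real.log n - Real.log k := by
    rw [← Real.log_div hn0.ne' hk0.ne']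
    exact Real.log_le_log (by linarith) hle
  have h1 : 1 ≤ Real.log n - Real.log k := by
    refine le_trans ?_ hlog
    have := Real.log_le_log (by norm_num) h3'
    linarith [Real.log_three_gt_d9]
  have hk1 : 0 ≤ Real.log k := Real.log_natCast_nonneg k
  have := log_factorial_le (by omega : 1 ≤ n / k)
  nlinarith

lemma le_log_factorial_div {n k : ℕ} (hk : 2 ≤ k) (hn : 3 * k ≤ n) :
    (n / k : ℝ) * (Real.log n - Real.log k - 1) - Real.log n ≤
      Real.log (n / k).factorial := by
  have hk0 : (0 : ℝ) < k := by exact_mod_cast (by omega : 0 < k)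
  have hn0 : (0 : ℝ) < n := by exact_mod_cast (by omega : 0 < n)
  have h3 : (3 : ℝ) ≤ n / k := by rw [le_div_iff₀ hk0]; exact_mod_cast hn
  have h3n : 3 ≤ n / k := (Nat.le_div_iff_mul_le (by omega)).2 hn
  have hle : (n / k : ℝ) ≤ (n / k + 1 : ℕ) := by
    push_cast
    exact (cast_div_lt_add_one n k).le
  have hlog : Real.log n - Real.log k ≤ Real.log (n / k + 1 : ℕ) := by
    rw [← Real.log_div hn0.ne' hk0.ne']
    exact Real.log_le_log (by linarith) hle
  have h1 : 1 ≤ Real.log n - Real.log k := by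
    rw [← Real.log_div hn0.ne' hk0.ne']
    have := Real.log_le_log (by norm_num) h3
    linarith [Real.log_three_gt_d9]
  have h2 : Real.log (n / k + 1 : ℕ) ≤ Real.log n := by
    refine Real.log_le_log (by positivity) ?_
    have : n / k + 1 ≤ n := by
      have := Nat.div_le_div_left hk (by norm_num) (a := n)
      omega
    exact_mod_cast this
  have h4 := mul_log_sub_le_log_factorial (Nat.succ_ne_zero (n / k))
  rw [Nat.factorial_succ, Nat.cast_mul, Real.log_mul (by positivity) (by positivity)] at h4
  have h5 : (n / k : ℝ) * (Real.log n - Real.log k - 1) ≤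
      ((n / k + 1 : ℕ) : ℝ) * (Real.log (n / k + 1 : ℕ) - 1) :=
    mul_le_mul hle (by linarith) (by linarith) (by positivity)
  simp only [Nat.succ_eq_add_one] at h4
  linarith

lemma le_psi {n : ℕ} (hn : 90 ≤ n) :
    0.92129 * n - 4 * Real.log n - 3 ≤ Chebyshev.psi n := by
  have h := log_factorial_combination_le_psi n
  have h1 := mul_log_sub_le_log_factorial (by omega : n ≠ 0)
  have h30 := le_log_factorial_div (by norm_num : 2 ≤ 30) (by omega : 3 * 30 ≤ n)
  have h2 := log_factorial_div_le (by norm_num : 1 ≤ 2) (by omega : 3 * 2 ≤ n)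
  have h3 := log_factorial_div_le (by norm_num : 1 ≤ 3) (by omega : 3 * 3 ≤ n)
  have h5 := log_factorial_div_le (by norm_num : 1 ≤ 5) (by omega : 3 * 5 ≤ n)
  have e : Real.log (30 : ℕ) = Real.log 2 + Real.log 3 + Real.log 5 := by
    rw [← Real.log_mul (by norm_num) (by norm_num), ← Real.log_mul (by norm_num) (by norm_num)]
    norm_num
  rw [e] at h30
  push_cast at h30 h2 h3 h5
  have hn0 : (0 : ℝ) < n := by exact_mod_cast (by omega : 0 < n)
  have g2 := mul_lt_mul_of_pos_left Real.log_two_gt_d9 hn0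
  have g3 := mul_lt_mul_of_pos_left Real.log_three_gt_d9 hn0
  have g5 := mul_lt_mul_of_pos_left Real.log_five_gt_d9 hn0
  nlinarith

lemma psi_sub_theta_le_mul_sqrt {x : ℝ} (hx : 1 ≤ x) :
    Chebyshev.psi x - Chebyshev.theta x ≤ 17 * √x := by
  have h := Chebyshev.psi_sub_theta_le_psi_add_psi_add_psi x
  have hx0 : 0 ≤ x := by linarith
  have h4 : Real.log 4 + 4 ≤ 17 / 3 := by
    rw [show (4 : ℝ) = 2 ^ 2 by norm_num, Real.log_pow]
    push_cast
    linarith [Real.log_two_lt_d9]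
  have key : ∀ c : ℝ, c ≤ 1 / 2 → Chebyshev.psi (x ^ c) ≤ 17 / 3 * √x := fun c hc => by
    refine (Chebyshev.psi_le_const_mul_self (Real.rpow_nonneg hx0 c)).trans ?_
    rw [Real.sqrt_eq_rpow]
    exact mul_le_mul h4 (Real.rpow_le_rpow_of_exponent_le hx hc) (Real.rpow_nonneg hx0 c)
      (by norm_num)
  linarith [key 2⁻¹ (by norm_num), key 3⁻¹ (by norm_num), key 5⁻¹ (by norm_num)]

lemma theta_add_le_primeCounting_mul_log (n : ℕ) :
    Chebyshev.theta n + Real.log 2 * (Nat.primeCounting (n / 2) + Nat.primeCounting (n / 4) +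
      Nat.primeCounting (n / 8)) ≤ Nat.primeCounting n * Real.log n := by
  have hpi : ∀ k, 1 ≤ k → (Nat.primeCounting (n / k) : ℝ) =
      ∑ p ∈ n.primesLE, if p * k ≤ n then (1 : ℝ) else 0 := fun k hk => by
    rw [← Nat.primesLE_card_eq_primeCounting, Finset.sum_boole]
    congr 2
    ext p
    simp only [Nat.mem_primesLE, Finset.mem_filter, Nat.le_div_iff_mul_le hk]
    constructor
    · rintro ⟨h1, h2⟩
      exact ⟨⟨(Nat.le_mul_of_pos_right p hk).trans h1, h2⟩, h1⟩
    · rintro ⟨⟨_, h2⟩, h1⟩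
      exact ⟨h1, h2⟩
  rw [hpi 2 (by norm_num), hpi 4 (by norm_num), hpi 8 (by norm_num),
    Chebyshev.theta_eq_sum_primesLE_log, ← Nat.primesLE_card_eq_primeCounting, ← nsmul_eq_mul,
    ← Finset.sum_const, ← Finset.sum_add_distrib, ← Finset.sum_add_distrib, Finset.mul_sum,
    ← Finset.sum_add_distrib]
  refine Finset.sum_le_sum fun p hp => ?_
  rw [Nat.mem_primesLE] at hp
  have hp0 : 0 < p := hp.2.pos
  have h2 : 0 < Real.log 2 := Real.log_pos (by norm_num)
  have key : ∀ k : ℕ, p * 2 ^ k ≤ n → Real.log p + k * Real.log 2 ≤ Real.log n := fun k hk => by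
    rw [← Real.log_pow, ← Real.log_mul (by positivity) (by positivity)]
    exact Real.log_le_log (by positivity) (by exact_mod_cast hk)
  have k0 := key 0 (by omega)
  split_ifs with c2 c4 c8 c8 c4 c8 c8
  · have := key 3 (by omega); push_cast at this; linarith
  · have := key 2 (by omega); push_cast at this; linarith
  all_goals first
    | omega
    | (have := key 1 (by omega); push_cast at this; linarith)
    | (push_cast at k0; linarith)

lemma le_primeCounting_mul_log {n : ℕ} (hn : 10 ^ 8 ≤ n) :
    0.918 * n * (1 + 0.605 / Real.log n) ≤ Nat.primeCounting n * Real.log n := by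
  have hn' : (10 : ℝ) ^ 8 ≤ n := by exact_mod_cast hn
  have hn0 : (0 : ℝ) < n := by linarith
  have hl : 0 < Real.log n := Real.log_pos (by linarith)
  have hlog : Real.log n ≤ n / 10 ^ 6 := by
    have h1 := Real.log_le_sub_one_of_pos (show (0 : ℝ) < n / 10 ^ 8 by positivity)
    rw [Real.log_div hn0.ne' (by norm_num), Real.log_pow, show (10 : ℝ) = 2 * 5 by norm_num,
      Real.log_mul (by norm_num) (by norm_num)] at h1
    push_cast at h1
    linarith [Real.log_two_lt_d9, Real.log_five_lt_d9]
  have hsq : √n ≤ n / 10 ^ 4 := by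
    rw [Real.sqrt_le_left (by positivity)]
    nlinarith
  have h1 := theta_add_le_primeCounting_mul_log n
  have h2 := psi_sub_theta_le_mul_sqrt (x := n) (by linarith)
  have h3 := le_psi (by omega : 90 ≤ n)
  have key : ∀ k : ℕ, 1 ≤ k → k ≤ 8 →
      0.9212 * (n / k : ℝ) ≤ Nat.primeCounting (n / k) * Real.log n := fun k hk hk8 => by
    have hk0 : (0 : ℝ) < k := by exact_mod_cast hk
    have hk8' : (k : ℝ) ≤ 8 := by exact_mod_cast hk8
    have hnk : 90 ≤ n / k := (Nat.le_div_iff_mul_le hk).2 (by nlinarith)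
    have hlt : (n / k : ℝ) < (n / k : ℕ) + 1 := cast_div_lt_add_one n k
    have hle : Real.log (n / k : ℕ) ≤ Real.log n :=
      Real.log_le_log (by exact_mod_cast (by omega : 0 < n / k))
        (by exact_mod_cast Nat.div_le_self n k)
    have hb : (n / 8 : ℝ) ≤ n / k := by gcongr
    have h4 := le_psi hnk
    have h5 := Chebyshev.psi_le_primeCounting_mul_log (n / k)
    have h6 : (Nat.primeCounting (n / k) : ℝ) * Real.log (n / k : ℕ) ≤
      Nat.primeCounting (n / k) * Real.log n := by gcongr
    nlinarith
  have k2 := key 2 (by norm_num) (by norm_num)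
  have k4 := key 4 (by norm_num) (by norm_num)
  have k8 := key 8 (by norm_num) (by norm_num)
  push_cast at k2 k4 k8
  have hs : 0.9212 * 0.875 * n / Real.log n ≤ Nat.primeCounting (n / 2) +
      Nat.primeCounting (n / 4) + Nat.primeCounting (n / 8) := by
    rw [div_le_iff₀ hl]
    linarith
  have hmul := mul_le_mul_of_nonneg_left hs (Real.log_pos (by norm_num : (1 : ℝ) < 2)).le
  have hd : 0 < n / Real.log n := by positivity
  have e1 : 0.918 * n * (1 + 0.605 / Real.log n) = 0.918 * n + 0.55539 * (n / Real.log n) := by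
    ring
  have e2 : Real.log 2 * (0.9212 * 0.875 * n / Real.log n) =
    Real.log 2 * (0.80605 * (n / Real.log n)) := by ring
  have e3 := mul_lt_mul_of_pos_right Real.log_two_gt_d9 hd
  rw [e1]
  rw [e2] at hmul
  linarith

lemma le_primeCounting {n : ℕ} {ℓ : ℝ} (hn : 10 ^ 8 ≤ n) (hℓ : Real.log n ≤ ℓ) :
    0.918 * n * (ℓ + 0.605) / ℓ ^ 2 ≤ Nat.primeCounting n := by
  have hn' : (10 : ℝ) ^ 8 ≤ n := by exact_mod_cast hn
  have hl : 0 < Real.log n := Real.log_pos (by linarith)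
  have hl' : 0 < ℓ := hl.trans_le hℓ
  have h := (div_le_iff₀ hl).2 (le_primeCounting_mul_log hn)
  refine le_trans ?_ h
  calc 0.918 * n * (ℓ + 0.605) / ℓ ^ 2 = 0.918 * n * (1 + 0.605 / ℓ) / ℓ := by field_simp
    _ ≤ 0.918 * n * (1 + 0.605 / Real.log n) / Real.log n := by gcongr

lemma two_pow_card_primeFactors_le {m : ℕ} (hm : m ≠ 0) : 2 ^ m.primeFactors.card ≤ m :=
  calc 2 ^ m.primeFactors.card ≤ ∏ p ∈ m.primeFactors, p :=
        Finset.pow_card_le_prod _ _ _ fun _ hp => (Nat.prime_of_mem_primeFactors hp).two_le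
    _ ≤ m := Nat.le_of_dvd (Nat.pos_of_ne_zero hm) (Nat.prod_primeFactors_dvd m)

/-- The largest `t` for which Chebyshev's bound yields `16 * T ≤ n * m` from
`φ(m) * 2 ^ 40 ≤ t * m`, where `m ≥ K₁` and `ℓ / 10 ^ 10` is a bound for `log (n * m / 16)`. -/
noncomputable def threshold (K₁ n ℓ : ℕ) : ℕ :=
  Nat.sub
    (Nat.div (Nat.mul (Nat.mul n 1099511627776) (Nat.mul 9180000000 (Nat.add ℓ 6050000000)))
      (Nat.mul 16 (Nat.mul ℓ ℓ)))
    (Nat.succ (Nat.div 54975581388800 K₁))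

lemma log_div_sixteen_le {n m K₂ j : ℕ} (hn : 0 < n) (hm : 0 < m) (hmK : m ≤ K₂)
    (h : (n * K₂) ^ 64 ≤ 2 ^ (256 + j)) (hx : 0 < n * m / 16) :
    Real.log (n * m / 16 : ℕ) ≤ ((108304247 * j : ℕ) : ℝ) / 10 ^ 10 := by
  have hK : 0 < n * K₂ := Nat.mul_pos hn (hm.trans_le hmK)
  have h1 : Real.log (((n * K₂) ^ 64 : ℕ) : ℝ) ≤ Real.log ((2 ^ (256 + j) : ℕ) : ℝ) :=
    Real.log_le_log (by positivity) (by exact_mod_cast h)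
  push_cast at h1
  rw [Real.log_pow, Real.log_pow] at h1
  have h2 : Real.log (n * m / 16 : ℕ) ≤ Real.log (n * K₂ / 16 : ℝ) := by
    refine Real.log_le_log (by exact_mod_cast hx) (Nat.cast_div_le.trans ?_)
    push_cast
    have : (m : ℝ) ≤ K₂ := by exact_mod_cast hmK
    gcongr
  have hK' : (0 : ℝ) < n * K₂ := by exact_mod_cast hK
  rw [Real.log_div hK'.ne' (by norm_num), show (16 : ℝ) = 2 ^ 4 by norm_num, Real.log_pow] at h2
  push_cast at h1 h2 ⊢
  have h3 := Real.log_two_lt_d9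
  have hj : (0 : ℝ) ≤ j := Nat.cast_nonneg j
  nlinarith

lemma Saturated.sixteen_mul_le {m T K₁ K₂ n j : ℕ} (h : Saturated m T) (hK₁ : 30000000 ≤ K₁)
    (hm₁ : K₁ ≤ m) (hm₂ : m ≤ K₂) (hm : m ≤ 2 * 10 ^ 11) (hn : 60 ≤ n)
    (hj : (n * K₂) ^ 64 ≤ 2 ^ (256 + j))
    (ht : m.totient * 1099511627776 ≤ threshold K₁ n (108304247 * j) * m) :
    16 * T ≤ n * m := by
  have hm0 : 0 < m := by omega
  have hx : 10 ^ 8 ≤ n * m / 16 := (Nat.le_div_iff_mul_le (by norm_num)).2 (by nlinarith)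
  have hlog := log_div_sixteen_le (by omega : 0 < n) hm0 hm₂ hj (by omega)
  have hx' : (10 : ℝ) ^ 8 ≤ (n * m / 16 : ℕ) := by exact_mod_cast hx
  set ℓ := 108304247 * j with hℓ
  have hpi := le_primeCounting hx hlog
  have hl18 : (18 : ℝ) ≤ (ℓ : ℝ) / 10 ^ 10 := by
    refine le_trans ?_ hlog
    have := Real.log_le_log (by norm_num) hx'
    rw [Real.log_pow, show (10 : ℝ) = 2 * 5 by norm_num,
      Real.log_mul (by norm_num) (by norm_num)] at this
    push_cast at this
    linarith [Real.log_two_gt_d9, Real.log_five_gt_d9]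
  have hl0 : (0 : ℝ) < ℓ := by linarith
  set g : ℝ := 9180000000 * (ℓ + 6050000000) / (ℓ * ℓ) with hg
  have hgx : g * (n * m / 16 : ℕ) ≤ Nat.primeCounting (n * m / 16) := by
    refine le_trans (le_of_eq ?_) hpi
    rw [hg]
    field_simp
    ring
  have hg0 : 0 < g := by positivity
  have hg1 : g ≤ 1 := by
    rw [hg, div_le_one (by positivity)]
    nlinarith
  have hx2 : (n * m / 16 : ℝ) < (n * m / 16 : ℕ) + 1 := by
    have := cast_div_lt_add_one (n * m) 16
    push_cast at this
    exact this
  have hφ : 0 < m.totient := Nat.totient_pos.2 hm0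
  have ht0 : 0 < threshold K₁ n ℓ := by
    rcases Nat.eq_zero_or_pos (threshold K₁ n ℓ) with h0 | h0
    · rw [h0] at ht; omega
    · exact h0
  have hsum : threshold K₁ n ℓ + (54975581388800 / K₁ + 1) ≤
      n * 1099511627776 * (9180000000 * (ℓ + 6050000000)) / (16 * (ℓ * ℓ)) := by
    have : threshold K₁ n ℓ = n * 1099511627776 * (9180000000 * (ℓ + 6050000000)) /
      (16 * (ℓ * ℓ)) - (54975581388800 / K₁ + 1) := rfl
    omega
  have hsum' : (threshold K₁ n ℓ : ℝ) + 54975581388800 / K₁ ≤ n * 1099511627776 * g / 16 := by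
    have h1 : ((threshold K₁ n ℓ + (54975581388800 / K₁ + 1) : ℕ) : ℝ) ≤
        ((n * 1099511627776 * (9180000000 * (ℓ + 6050000000)) / (16 * (ℓ * ℓ)) : ℕ) : ℝ) := by
      exact_mod_cast hsum
    have h2 := h1.trans Nat.cast_div_le
    have h3 := cast_div_lt_add_one 54975581388800 K₁
    push_cast at h2 h3
    rw [hg]
    calc (threshold K₁ n ℓ : ℝ) + 54975581388800 / K₁ ≤ _ := by linarith
      _ ≤ _ := h2
      _ = _ := by field_simp
  have ht' : (m.totient : ℝ) * 1099511627776 ≤ threshold K₁ n ℓ * m := by exact_mod_cast ht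
  have hm0' : (0 : ℝ) < m := by exact_mod_cast hm0
  have hK0' : (0 : ℝ) < K₁ := by exact_mod_cast (by omega : 0 < K₁)
  have hmK : (54975581388800 : ℝ) ≤ 54975581388800 / K₁ * m := by
    rw [div_mul_eq_mul_div, le_div_iff₀ hK0']
    have : (K₁ : ℝ) ≤ m := by exact_mod_cast hm₁
    linarith
  have hmul := mul_le_mul_of_nonneg_right hsum' hm0'.le
  have hω : m.primeFactors.card ≤ 40 := by
    by_contra! hc
    have h1 := two_pow_card_primeFactors_le hm0.ne'
    have h2 : 2 ^ 40 ≤ 2 ^ m.primeFactors.card := Nat.pow_le_pow_right (by norm_num) hc.le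
    omega
  have hω' : (m.primeFactors.card : ℝ) ≤ 40 := by exact_mod_cast hω
  have hfin : (m.totient + m.primeFactors.card : ℝ) ≤ Nat.primeCounting (n * m / 16) := by
    have : g * (n * m / 16) ≤ g * ((n * m / 16 : ℕ) + 1) := by gcongr
    nlinarith
  have hT := h.bound (n * m / 16) (by exact_mod_cast hfin)
  omega

/-- The primes in `ps` can be assigned residues so that each `j < N` is hit. -/
def Covers (N : ℕ) (ps : List ℕ) : Prop :=
  ∃ f : ℕ → ℕ, ∀ j < N, ∃ p ∈ ps, j ≡ f p [MOD p]

/-- Every `L` consecutive integers contain two that are coprime to `m`. -/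
def TwoCoprime (m L : ℕ) : Prop :=
  ∀ u, ∃ s t, s < t ∧ t < L ∧ (u + s).Coprime m ∧ (u + t).Coprime m

lemma exists_add_mul_modEq_zero {ps : List ℕ} (hps : ps.Pairwise Nat.Coprime)
    (h0 : ∀ p ∈ ps, p ≠ 0) (f : ℕ → ℕ) (c m : ℕ) :
    ∃ s < ps.prod, ∀ p ∈ ps, p ∣ c + s + f p * m := by
  have hlt := Nat.chineseRemainderOfList_lt_prod (fun p => (p - 1) * (c + f p * m)) id ps hps h0
  have hs := (Nat.chineseRemainderOfList (fun p => (p - 1) * (c + f p * m)) id ps hps).2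
  refine ⟨_, hlt.trans_eq (by simp), fun p hp => ?_⟩
  have h1 := hs p hp
  have hp1 : p - 1 + 1 = p := Nat.succ_pred_eq_of_ne_zero (h0 p hp)
  have h2 := (h1.add_left c).add_right (f p * m)
  rw [id] at h2
  refine (Nat.modEq_zero_iff_dvd.1 (h2.trans (Nat.modEq_zero_iff_dvd.2 ?_)))
  exact ⟨c + f p * m, by nth_rewrite 4 [← hp1]; ring⟩

lemma exists_mul_modEq {P m : ℕ} (h : P.Coprime m) (r : ℕ) : ∃ u, P * u ≡ r [MOD m] := by
  obtain ⟨x, hx0, hx⟩ := Nat.chineseRemainder h 0 r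
  obtain ⟨u, rfl⟩ := Nat.modEq_zero_iff_dvd.1 hx0
  exact ⟨u, hx⟩

theorem Saturated.false_of_covers {m T N L lo : ℕ} {ps : List ℕ} (h : Saturated m T)
    (hps : ∀ p ∈ ps, p.Prime ∧ ¬ p ∣ m ∧ p < lo) (hnd : ps.Nodup) (hcov : Covers N ps)
    (hT : T < lo + N * m) (hL : L * ps.prod + lo ≤ m) (hgap : TwoCoprime m L) : False := by
  obtain ⟨f, hf⟩ := hcov
  have hco : ps.Pairwise Nat.Coprime := hnd.imp_of_mem fun {p q} hp hq hne =>
    (Nat.coprime_primes (hps p hp).1 (hps q hq).1).2 hne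
  obtain ⟨s, hs, hdvd⟩ := exists_add_mul_modEq_zero hco (fun p hp => (hps p hp).1.ne_zero) f lo m
  have hP : ps.prod.Coprime m := by
    rw [Nat.coprime_list_prod_left_iff]
    exact fun p hp => (Nat.Prime.coprime_iff_not_dvd (hps p hp).1).2 (hps p hp).2.1
  obtain ⟨u, hu⟩ := exists_mul_modEq hP (lo + s)
  have key : ∀ t < L, (u + t).Coprime m → lo + s + ps.prod * t = m / 2 + 2 := by
    intro t ht hc
    by_contra hne
    have hlt : lo + s + ps.prod * t < m := by
      have : ps.prod * (t + 1) ≤ ps.prod * L := Nat.mul_le_mul_left _ ht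
      nlinarith
    have hc' : (lo + s + ps.prod * t).Coprime m := by
      have h1 : ps.prod * (u + t) ≡ lo + s + ps.prod * t [MOD m] := by
        rw [mul_add]
        exact hu.add_right _
      exact h1.gcd_eq.symm.trans (Nat.Coprime.mul_left hP hc)
    obtain ⟨p, hp, hpT, hpr⟩ := h.cover _ hlt hc' hne
    have hdm := Nat.div_add_mod p m
    rw [hpr] at hdm
    have hj : p / m < N := by
      by_contra! hj
      have : m * N ≤ m * (p / m) := Nat.mul_le_mul_left _ hj
      nlinarith
    obtain ⟨q, hq, hqj⟩ := hf _ hj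
    have hqp : q ∣ p := by
      have h2 : ps.prod * t ≡ 0 [MOD q] :=
        Nat.modEq_zero_iff_dvd.2 ((List.dvd_prod hq).mul_right t)
      have h3 := (h2.add_left (lo + s)).add (hqj.mul_right m)
      rw [add_zero, mul_comm _ m, add_comm, hdm] at h3
      exact Nat.modEq_zero_iff_dvd.1 (h3.trans (Nat.modEq_zero_iff_dvd.2 (hdvd q hq)))
    have := (Nat.prime_dvd_prime_iff_eq (hps q hq).1 hp).1 hqp
    have := (hps q hq).2.2
    have : 0 ≤ m * (p / m) := Nat.zero_le _
    omega
  obtain ⟨a, b, hab, hb, hca, hcb⟩ := hgap u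
  have e1 := key a (hab.trans hb) hca
  have e2 := key b hb hcb
  have hP0 : 0 < ps.prod := by omega
  have := Nat.mul_lt_mul_of_pos_left hab hP0
  omega

/-- `f n`, written so that the kernel evaluates `n` before unfolding `f`. -/
noncomputable def force (n : ℕ) (f : ℕ → Bool) : Bool :=
  Nat.rec (f 0) (fun k _ => f (Nat.succ k)) n

lemma force_eq (n : ℕ) (f : ℕ → Bool) : force n f = f n := by cases n <;> rfl

/-- The `i`-th digit of `T` in base `256`. -/
noncomputable def entry (T i : ℕ) : ℕ := Nat.land (Nat.shiftRight T (Nat.mul 8 i)) 255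

/-- The `i`-th digit of `T` in base `32`. -/
noncomputable def entry5 (T i : ℕ) : ℕ := Nat.land (Nat.shiftRight T (Nat.mul 5 i)) 31

/-- `f true && f false`. -/
noncomputable def both (f : Bool → Bool) : Bool := and (f true) (f false)

lemma both_eq_true {f : Bool → Bool} (h : both f = true) (d : Bool) : f d = true := by
  rw [both, Bool.and_eq_true] at h
  cases d
  exacts [h.2, h.1]

/-- `x * p` if `d`, else `x`. -/
noncomputable def mulIf (d : Bool) (p x : ℕ) : ℕ := cond d (Nat.mul p x) x

/-- The number of integers in `[u, u + L)` that are coprime to `M`. -/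
def coprimeCount (M u L : ℕ) : ℕ := ((Finset.range L).filter fun t => (u + t).Coprime M).card

lemma coprimeCount_succ (M u L : ℕ) :
    coprimeCount M u (L + 1) = coprimeCount M u L + if (u + L).Coprime M then 1 else 0 := by
  rw [coprimeCount, Finset.range_add_one, Finset.filter_insert]
  split_ifs with h
  · rw [Finset.card_insert_of_notMem (by simp)]; rfl
  · rfl

lemma coprimeCount_mono (M u : ℕ) {L L' : ℕ} (h : L ≤ L') :
    coprimeCount M u L ≤ coprimeCount M u L' :=
  Finset.card_le_card (Finset.filter_subset_filter _ (Finset.range_subset_range.2 h))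

lemma coprimeCount_mod (M u L : ℕ) : coprimeCount M (u % M) L = coprimeCount M u L := by
  rw [coprimeCount, coprimeCount]
  congr 1
  refine Finset.filter_congr fun t _ => ?_
  rw [Nat.Coprime, Nat.Coprime, ((Nat.mod_modEq u M).add_right t).gcd_eq]

/-- The digits of `mn` and `mx` bound `coprimeCount M`. -/
def TableValid (M mn mx : ℕ) : Prop :=
  ∀ L ≤ 150, ∀ u, entry mn L ≤ coprimeCount M u L ∧ coprimeCount M u L ≤ entry mx L

/-- Check the tables for the interval lengths `L, …, L + k - 1`, where `c` is the number of
integers coprime to `M` among the `L` integers preceding `x`. -/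
noncomputable def tableRun (M mn mx k : ℕ) : ℕ → ℕ → ℕ → Bool :=
  Nat.rec (fun _ _ _ => true) (fun _ ih x L c =>
    and (and (Nat.ble (entry mn L) c) (Nat.ble c (entry mx L)))
      (force (Nat.succ x) fun x' => force (Nat.succ L) fun L' =>
        force (Bool.rec c (Nat.succ c) (Nat.beq (Nat.gcd x M) 1)) fun c' => ih x' L' c')) k

/-- Check the tables for all intervals starting at some `u < k`. -/
noncomputable def tableTest (M mn mx k : ℕ) : Bool :=
  Nat.rec true (fun u ih => and ih (tableRun M mn mx 151 u 0 0)) k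

lemma tableRun_succ (M mn mx k x L c : ℕ) :
    tableRun M mn mx (k + 1) x L c = (Nat.ble (entry mn L) c && Nat.ble c (entry mx L) &&
      tableRun M mn mx k (x + 1) (L + 1) (c + if x.Coprime M then 1 else 0)) := by
  have h : tableRun M mn mx (k + 1) x L c = (Nat.ble (entry mn L) c && Nat.ble c (entry mx L) &&
      force (Nat.succ x) fun x' => force (Nat.succ L) fun L' =>
        force (Bool.rec c (Nat.succ c) (Nat.beq (Nat.gcd x M) 1)) fun c' =>
          tableRun M mn mx k x' L' c') := rfl
  rw [h, force_eq, force_eq, force_eq]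
  by_cases hc : x.Coprime M
  · rw [if_pos hc, hc.gcd_eq_one]
    rfl
  · have e : Nat.beq (Nat.gcd x M) 1 = false := by
      rw [Bool.eq_false_iff, Ne, Nat.beq_eq]
      exact hc
    rw [if_neg hc, e]
    rfl

lemma tableRun_spec {M mn mx k u L : ℕ}
    (h : tableRun M mn mx k (u + L) L (coprimeCount M u L) = true) :
    ∀ L' < L + k, L ≤ L' →
      entry mn L' ≤ coprimeCount M u L' ∧ coprimeCount M u L' ≤ entry mx L' := by
  induction k generalizing L with
  | zero => intro L' h1 h2; omega
  | succ k ih =>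
    rw [tableRun_succ, ← coprimeCount_succ, Bool.and_eq_true, Bool.and_eq_true, Nat.ble_eq,
      Nat.ble_eq] at h
    intro L' h1 h2
    rcases h2.eq_or_lt with rfl | h2
    · exact h.1
    · exact ih (L := L + 1) h.2 L' (by omega) h2

lemma tableValid_of_tableTest {M mn mx : ℕ} (hM : 0 < M) (h : tableTest M mn mx M = true) :
    TableValid M mn mx := by
  have key : ∀ k, tableTest M mn mx k = true → ∀ u < k, tableRun M mn mx 151 u 0 0 = true := by
    intro k
    induction k with
    | zero => intro _ u hu; omega
    | succ k ih =>
      intro hk u hu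
      have hk' : (tableTest M mn mx k && tableRun M mn mx 151 k 0 0) = true := hk
      rw [Bool.and_eq_true] at hk'
      rcases Nat.lt_succ_iff_lt_or_eq.1 hu with hu | rfl
      · exact ih hk'.1 u hu
      · exact hk'.2
  intro L hL u
  rw [← coprimeCount_mod]
  exact tableRun_spec (L := 0) (key M h _ (Nat.mod_lt u hM)) L (by omega) (Nat.zero_le _)

def minTable : Bool → Bool → Bool → ℕ
  | true, true, true =>
    570370571393557997916997524200374907460940892767095740038974061554587754855268311504763281535455642175110721365116056104930269362096592896478474012967152131776196239056313397359151732556269718398487234139295907609483610554743414733649268777969280335835596667172469574156445224239645720037002199223430567745074511866287085085656785469196808461140676593789614161920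
  | true, true, false =>
    691372591730198253000936400037548449870912582276300015505019419604520160309781854328736683446700739130234455114736522789892467033993398383333581758526024319857171000142982876558252609869588792812771794558520623814670374677442227314622388483991265357208279111416437286151425576360993554410785508987347344020585523389504554419830571307056946439865277051221342945280
  | true, false, true =>
    725944597540666897619065125030591660993693787258573404386370508081429187772605745264201234601987584124088994285990661922668390433445634040865610416959943674305570018313280983442233075035275132756013058505157687217521530068485798580787722675219780859625822229684532918909306862524059890779980816821105107210316111265976894792990073394442072759154278873566181064704
  | true, false, false =>
    864232620782541474892122623182233731575416501609448613677398455622113050481206526058922239689805368613513577158561982651568550594362298669672892144127799153473775935108709544446051837392757822663261161847619355672033093042361146704909650243165042303102261162091522477745190471168212128091099714671669760095944736818486393931519033480802806419292891318899127091200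
  | false, true, true =>
    881518623687760075793079244197490626398239163767713916404580293315180381831187811216730495183644058665370370294868769061345200005886763555550616620020799788894053164827437371592106443991286682120756767839320590667900944771836589345960900894626940941161943626527809769573412292166340193154844643163126976346654127984457670814397820664386321203207508454418048614400
  | false, true, false =>
    1037092649834868975255255364663601225151712704529706288053747210497715705370111670775438007850003218593443644194090663392153454321818777147502872076833082165626405626496096074156553337577713321146693109367439988371105501115424533957530322002935360035320001453169456174993449599323435464602999091703080400326020353449418016226743516291678922772310507661826866544640
  | false, false, true =>
    1106236661455806264011729853921475337838716010171146896515656494359789420971724960248258222186670725124647520775123038104618398436872005728044821004897272591784430141855607535668626909320693682617282301228110612636526899711003277723600088080595467229438811107767065500804871499170494023077639345304582633581797786799450554713570950581251321611502354592391795572736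
  | false, false, false =>
    1296382693413383808092031038927132380971462767259949180866168662818293063105521673045213010266356219713841040690882716007479973786213655073731971336987453441072769266957665699403501394068571917866695257397568509333325237113113325649184687066364824856427851721493725532784901418651263210929098734147191508281442403138898676844679038217758031366249694054372253696000

def maxTable : Bool → Bool → Bool → ℕ
  | true, true, true =>
    622296104584410826213423048205165333540907110035017668676575802991892427550860611258809166585121863634073130265454407181957222041242879726423762006892100672789510698369509837643438083131319437984657729664415153332082494469354820309147338653791280109802375214870140611583510561039196494022954397840080809225066207805528959077336767802202777010602720971972696670464
  | true, true, false =>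
    691440116209372826152525905068919024971049751827736877965812220951149638807812713731272169171551201721353161322700216308940714236352212957080112610104857648390369248822354372403045541890698531168111491025004256869606948741953623021091630244837741683620452705935034940432789355458145068453115788005063469660385342994657897430364905846150290508403649991081635938560
  | true, false, true =>
    760584127826285403726372026720695378884522101551241520176046915406902288813219254748319657278447335826420652038361175191382258110102082307537379486073663365138258240249718096442161816767752083738816842684838986356351015208383610584736122288898040117865637101388871115351972492318635822091691818394839065921369941002666096327751623031499633914437019928035617472768
  | true, false, false =>
    864300145257691336861083760607506547915027060017944217116369471289221403332863035874388541039788178745326709599775744825766954631834194765756116147773032577698891889228368788447554706023821855984789339551239971447449560965300556720345343343242920824263314724747755331544312929434961572237674994858388592021836884527128597811140328120133238239441916767699686457600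
  | false, true, true =>
    898872151068159981238383929141489494621762972865346045357558648061238379396372472182185852544023542370892543401741696142241886471606049534154338524425770106800182371817082330768109460331143635808530925784280545256566875997516924409584420988411771963564231971166448613578654788311464747950510054021972413390091106059727872650241160133626261077054133930828610208000
  | false, true, false =>
    1037160174310034558751332907657237716666606522758729422460950907922932082285065678012387633912002400464124828234732453275895934492097671193445352352507877809824496035656535873137482213439042879012654906973714258245587008283722913182505393950655463868664841533480669421827427363734767664703023610444374315823326657120055108162158590456217244790950249292725410136320
  | false, false, true =>
    1123589925072734104964226600305289670444547487229683485774098327973035740533648154433612397500126194195149381312789904240602321402917436841396089087973117830932168476449887687517837962477986559353197570942656232379495004481399301039393683392281358865298364360967891108095818653734434181649512220598195537537705536947210617137181206984699784540258702934573431456000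
  | false, false, false =>
    1296449954125077326855412823449756772131664132343260920617751232569189509120886865490144203614056416979735010492595879693548088194413646667006136254239761040853653265323252697704645919559584493347151808180638491456934228102591141619059070716305835090950560078967542413766034415250309100477484849866086057420923387843231675173341591208437035892717926202977611219200

def coverTable : Bool → Bool → Bool → Bool → Bool → ℕ
  | true, true, true, true, true => 775628046757751184266453157920
  | true, true, true, true, false => 734736091949762868757443741728
  | true, true, true, false, true => 734736091911716459105417791520
  | true, true, true, false, false => 693844138284319764313819678752
  | true, true, false, true, true => 693844138284282573333010155552
  | true, true, false, true, false => 652952222435817741498573752352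
  | true, true, false, false, true => 652952183439400769676581636128
  | true, true, false, false, false => 612060267590935937842145232928
  | true, false, true, true, true => 652952221217143682296684054560
  | true, false, true, true, false => 612060267589746987505085941792
  | true, false, true, false, true => 612060266372261878640255535136
  | true, false, true, false, false => 571169559449616661434993838112
  | true, false, false, true, true => 571169559448426550049089095712
  | true, false, false, true, false => 530278852525781332843827398688
  | true, false, false, false, true => 530277604640438234540079679520
  | true, false, false, false, false => 489425583344020685468408580128
  | false, true, true, true, true => 531554230269056667767337486368
  | false, true, true, true, false => 490662276641659972975739373600
  | false, true, true, false, true => 490662275461068352258328070176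
  | false, true, true, false, false => 449770321833671657466729957408
  | false, true, false, true, true => 490662275422984752725004224544
  | false, true, false, true, false => 449810254126567203653333125152
  | false, true, false, false, true => 449770320614996437215994808352
  | false, true, false, false, false => 408918299318578888144323708960
  | false, false, true, true, true => 449771568500339534420230899744
  | false, false, true, true, false => 408918300499170507762223384608
  | false, false, true, false, true => 408879613692351218911221483552
  | false, false, true, false, false => 368026345691182192253213968416
  | false, false, false, true, true => 408879613654267619377897637920
  | false, false, false, true, false => 368027592357850070306226538528
  | false, false, false, false, true => 367987658846279303868888221728
  | false, false, false, false, false => 327135637549861754797217122336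

/-- The product of `2` and those of `3, 5, 7` that are selected. -/
noncomputable def baseModulus (d₃ d₅ d₇ : Bool) : ℕ := mulIf d₃ 3 (mulIf d₅ 5 (mulIf d₇ 7 2))

lemma tableValid_minTable_maxTable (d₃ d₅ d₇ : Bool) :
    TableValid (baseModulus d₃ d₅ d₇) (minTable d₃ d₅ d₇) (maxTable d₃ d₅ d₇) := by
  have h : both (fun d₃ => both fun d₅ => both fun d₇ => tableTest (baseModulus d₃ d₅ d₇)
      (minTable d₃ d₅ d₇) (maxTable d₃ d₅ d₇) (baseModulus d₃ d₅ d₇)) = true := by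
    decide +kernel
  refine tableValid_of_tableTest ?_ (both_eq_true (both_eq_true (both_eq_true h d₃) d₅) d₇)
  cases d₃ <;> cases d₅ <;> cases d₇ <;> simp [baseModulus, mulIf]

/-- The shorter of two lists. -/
def shorter (x y : List ℕ) : List ℕ := bif x.length.ble y.length then x else y

lemma shorter_eq (x y : List ℕ) : shorter x y = x ∨ shorter x y = y := by
  rw [shorter]
  cases x.length.ble y.length
  exacts [Or.inr rfl, Or.inl rfl]

/-- Remove from `cells` a residue class modulo `p` that contains as many of them as possible. -/
def removeBest (p : ℕ) (cells : List ℕ) : ℕ → List ℕ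
  | 0 => cells.filter fun j => !(j % p).beq 0
  | r + 1 => shorter (removeBest p cells r) (cells.filter fun j => !(j % p).beq (r + 1))

/-- Whether `cells` can be covered by one residue class for each of the first `c` members of a
list of distinct primes that starts with `small`, when the classes for `small` are chosen
greedily and the others are only used for one cell each. -/
def coverRun : List ℕ → ℕ → List ℕ → Bool
  | [], c, cells => cells.length.ble c
  | _ :: _, 0, cells => cells.length.ble 0
  | p :: small, c + 1, cells => coverRun small c (removeBest p cells p)

lemma removeBest_spec (p : ℕ) (cells : List ℕ) (n : ℕ) :
    ∃ r, removeBest p cells n = cells.filter fun j => !(j % p).beq r := by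
  induction n with
  | zero => exact ⟨0, rfl⟩
  | succ n ih =>
    rw [removeBest]
    rcases shorter_eq (removeBest p cells n) (cells.filter fun j => !(j % p).beq (n + 1)) with h | h
    exacts [ih.imp fun _ hr => h.trans hr, ⟨n + 1, h⟩]

lemma exists_cover_of_length_le {cells ps : List ℕ} (hps : ps.Nodup)
    (h : cells.length ≤ ps.length) :
    ∃ f : ℕ → ℕ, ∀ j ∈ cells, ∃ p ∈ ps, j ≡ f p [MOD p] := by
  induction cells generalizing ps with
  | nil => exact ⟨id, by simp⟩
  | cons i cells ih =>
    obtain _ | ⟨p, ps⟩ := ps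
    · simp at h
    obtain ⟨hp, hps⟩ := List.nodup_cons.1 hps
    obtain ⟨f, hf⟩ := ih hps (by simpa using h)
    refine ⟨Function.update f p i,
      List.forall_mem_cons.2 ⟨⟨p, by simp, by simp [Nat.ModEq.refl]⟩, ?_⟩⟩
    intro j hj
    obtain ⟨q, hq, hjq⟩ := hf j hj
    refine ⟨q, List.mem_cons_of_mem _ hq, ?_⟩
    rwa [Function.update_of_ne (ne_of_mem_of_not_mem hq hp)]

lemma exists_cover_of_coverRun {small ps cells : List ℕ} {c : ℕ} (hps : (small ++ ps).Nodup)
    (hc : c ≤ (small ++ ps).length) (h : coverRun small c cells = true) :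
    ∃ f : ℕ → ℕ, ∀ j ∈ cells, ∃ p ∈ (small ++ ps).take c, j ≡ f p [MOD p] := by
  induction small generalizing c cells with
  | nil =>
    refine exists_cover_of_length_le (hps.sublist (List.take_sublist _ _)) ?_
    rw [List.length_take, min_eq_left hc]
    simpa [coverRun] using h
  | cons p small ih =>
    obtain _ | c := c
    · refine exists_cover_of_length_le (hps.sublist (List.take_sublist _ _)) ?_
      simpa [coverRun] using h
    · rw [List.cons_append] at hps hc
      obtain ⟨hp, hps⟩ := List.nodup_cons.1 hps
      obtain ⟨f, hf⟩ := ih hps (by simpa using hc) h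
      obtain ⟨r, hr⟩ := removeBest_spec p cells p
      rw [hr] at hf
      refine ⟨Function.update f p r, fun j hj => ?_⟩
      rw [List.cons_append, List.take_succ_cons]
      by_cases hjr : j % p = r
      · refine ⟨p, by simp, ?_⟩
        rw [Function.update_self, ← hjr]
        exact (Nat.mod_modEq j p).symm
      · obtain ⟨q, hq, hjq⟩ := hf j (List.mem_filter.2
          ⟨hj, by simpa [Nat.beq_eq, ← Bool.not_eq_true] using hjr⟩)
        refine ⟨q, List.mem_cons_of_mem _ hq, ?_⟩
        rwa [Function.update_of_ne (ne_of_mem_of_not_mem (List.mem_of_mem_take hq) hp)]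

/-- `l` if `d`, else `p :: l`. -/
noncomputable def cand (d : Bool) (p : ℕ) (l : List ℕ) : List ℕ := cond d l (p :: l)

/-- Those of `3, 5, 7, 11, 13` that are not selected. -/
noncomputable def smallCand (d₃ d₅ d₇ d₁₁ d₁₃ : Bool) : List ℕ :=
  cand d₃ 3 (cand d₅ 5 (cand d₇ 7 (cand d₁₁ 11 (cand d₁₃ 13 []))))

/-- The digits of `nd` bound the number of primes needed to cover an initial segment. -/
def CoverValid (nd : ℕ) (small : List ℕ) : Prop :=
  ∀ N ≤ 19, ∀ ps, (small ++ ps).Nodup → entry5 nd N ≤ (small ++ ps).length →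
    Covers N ((small ++ ps).take (entry5 nd N))

lemma coverValid_coverTable (d₃ d₅ d₇ d₁₁ d₁₃ : Bool) :
    CoverValid (coverTable d₃ d₅ d₇ d₁₁ d₁₃) (smallCand d₃ d₅ d₇ d₁₁ d₁₃) := by
  have h : both (fun d₃ => both fun d₅ => both fun d₇ => both fun d₁₁ => both fun d₁₃ =>
      (List.range 20).all fun N => coverRun (smallCand d₃ d₅ d₇ d₁₁ d₁₃)
        (entry5 (coverTable d₃ d₅ d₇ d₁₁ d₁₃) N) (List.range N)) = true := by
    decide +kernel
  intro N hN ps hps hlen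
  have h' := both_eq_true (both_eq_true (both_eq_true (both_eq_true (both_eq_true h d₃) d₅) d₇)
    d₁₁) d₁₃
  obtain ⟨f, hf⟩ := exists_cover_of_coverRun hps hlen
    (List.all_eq_true.1 h' N (List.mem_range.2 (by omega)))
  exact ⟨f, fun j hj => hf j (List.mem_range.2 hj)⟩

/-- `⌈L / q⌉` for `q ≠ 0`. -/
noncomputable def ceilDiv (L q : ℕ) : ℕ := Nat.div (Nat.add L (Nat.pred q)) q

/-- Add to a number the bounds for the numbers of multiples of the members of a list. -/
noncomputable def kills (mx L : ℕ) (l : List ℕ) : ℕ → ℕ :=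
  List.rec (fun x => x) (fun p _ ih x => ih (Nat.add x (entry mx (ceilDiv L p)))) l

/-- The largest `e ≤ n` such that `q ^ e ≤ Q`. -/
noncomputable def expo (q : ℕ) (n : ℕ) : ℕ → ℕ :=
  Nat.rec (fun _ => 0) (fun _ ih Q => Bool.rec 0 (Nat.succ (ih (Nat.div Q q))) (Nat.ble q Q)) n

lemma le_ceilDiv_mul {q : ℕ} (hq : 0 < q) (L : ℕ) : L ≤ ceilDiv L q * q := by
  have h := Nat.lt_div_mul_add (a := L + (q - 1)) hq
  have : ceilDiv L q = (L + (q - 1)) / q := rfl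
  rw [this]
  omega

lemma ceilDiv_le_iff {L q c : ℕ} (hq : 0 < q) : ceilDiv L q ≤ c ↔ L ≤ c * q := by
  have : ceilDiv L q = (L + (q - 1)) / q := rfl
  rw [this, ← Nat.lt_succ_iff, Nat.div_lt_iff_lt_mul hq, Nat.succ_mul]
  omega

lemma card_filter_dvd_le {p : ℕ} (hp : 0 < p) (M u L : ℕ) :
    ((Finset.range L).filter fun t => (u + t).Coprime M ∧ p ∣ u + t).card ≤
      coprimeCount M (ceilDiv u p) (ceilDiv L p) := by
  refine Finset.card_le_card_of_injOn (fun t => (u + t) / p - ceilDiv u p) ?_ ?_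
  · intro t ht
    simp only [Finset.coe_filter, Finset.mem_range, Set.mem_ofPred_eq] at ht ⊢
    obtain ⟨htL, hc, v, hv⟩ := ht
    have h1 : ceilDiv u p ≤ v := (ceilDiv_le_iff hp).2 (by rw [mul_comm, ← hv]; omega)
    rw [hv, Nat.mul_div_cancel_left v hp]
    refine ⟨?_, ?_⟩
    · have h2 := le_ceilDiv_mul hp u
      have h3 := le_ceilDiv_mul hp L
      have h4 : v * p < (ceilDiv u p + ceilDiv L p) * p := by
        rw [add_mul, mul_comm v, ← hv]
        omega
      have := Nat.lt_of_mul_lt_mul_right h4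
      omega
    · rw [Nat.add_sub_cancel' h1]
      rw [hv] at hc
      exact hc.coprime_mul_left
  · intro t ht t' ht' h
    simp only [Finset.coe_filter, Set.mem_ofPred_eq] at ht ht'
    obtain ⟨-, -, v, hv⟩ := ht
    obtain ⟨-, -, v', hv'⟩ := ht'
    have h1 : ceilDiv u p ≤ v := (ceilDiv_le_iff hp).2 (by rw [mul_comm, ← hv]; omega)
    have h1' : ceilDiv u p ≤ v' := (ceilDiv_le_iff hp).2 (by rw [mul_comm, ← hv']; omega)
    simp only [hv, hv', Nat.mul_div_cancel_left _ hp] at h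
    have : v = v' := by omega
    subst this
    omega

lemma kills_eq (mx L : ℕ) (l : List ℕ) (x : ℕ) :
    kills mx L l x = x + (l.map fun p => entry mx (ceilDiv L p)).sum := by
  induction l generalizing x with
  | nil => rfl
  | cons p l ih =>
    rw [List.map_cons, List.sum_cons, ← add_assoc]
    exact ih _

lemma le_expo {q n Q j : ℕ} (hq : 0 < q) (hj : j ≤ n) (h : q ^ j ≤ Q) : j ≤ expo q n Q := by
  induction n generalizing Q j with
  | zero => exact hj
  | succ n ih =>
    obtain _ | j := j
    · exact Nat.zero_le _
    · have hQ : q ≤ Q := le_trans (Nat.le_self_pow (by omega) q) h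
      have e : expo q (n + 1) Q = Bool.rec 0 (Nat.succ (expo q n (Nat.div Q q))) (Nat.ble q Q) :=
        rfl
      rw [e, Nat.ble_eq_true_of_le hQ]
      refine Nat.succ_le_succ (ih (by omega) ?_)
      exact (Nat.le_div_iff_mul_le hq).2 (by rwa [← pow_succ])

lemma ceilDiv_le_self {q : ℕ} (hq : 0 < q) (L : ℕ) : ceilDiv L q ≤ L :=
  (ceilDiv_le_iff hq).2 (Nat.le_mul_of_pos_right L hq)

lemma coprimeCount_le_sum {M mn mx L u : ℕ} (hv : TableValid M mn mx) (hL : L ≤ 150)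
    {l : List ℕ} (hl : ∀ p ∈ l, 0 < p) :
    coprimeCount M u L ≤
      ((Finset.range L).filter fun t => (u + t).Coprime M ∧ ∀ p ∈ l, ¬ p ∣ u + t).card +
        (l.map fun p => entry mx (ceilDiv L p)).sum := by
  induction l with
  | nil => simp [coprimeCount]
  | cons p l ih =>
    obtain ⟨hp, hl⟩ := List.forall_mem_cons.1 hl
    refine (ih hl).trans ?_
    rw [List.map_cons, List.sum_cons, ← add_assoc]
    refine Nat.add_le_add_right ?_ _
    refine (Finset.card_le_card (t := _ ∪ _) ?_).trans ((Finset.card_union_le _ _).trans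
      (Nat.add_le_add_left (((card_filter_dvd_le hp M u L).trans
        (hv _ ((ceilDiv_le_self hp L).trans hL) _).2)) _))
    intro t ht
    simp only [Finset.mem_union, Finset.mem_filter, List.forall_mem_cons] at ht ⊢
    tauto

lemma twoCoprime_of_kills {m M mn mx L q e : ℕ} {rest : List ℕ} (hm : m ≠ 0) (hq : 0 < q)
    (hv : TableValid M mn mx) (hL : L ≤ 150) (hrest : ∀ p ∈ rest, 0 < p)
    (hfac : ∀ p, p.Prime → p ∣ m → p ∣ M ∨ p ∈ rest ∨ q ≤ p)
    (hcard : (m.primeFactors.filter fun p => ¬ p ∣ M ∧ p ∉ rest).card ≤ e)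
    (h : 2 + kills mx L rest (e * entry mx (ceilDiv L q)) ≤ entry mn L) :
    TwoCoprime m L := by
  intro u
  set U := m.primeFactors.filter fun p => ¬ p ∣ M ∧ p ∉ rest with hU
  have h1 := coprimeCount_le_sum (u := u) hv hL hrest
  have h2 := (hv L hL u).1
  rw [kills_eq] at h
  have h3 : ((Finset.range L).filter fun t => (u + t).Coprime M ∧ ∀ p ∈ rest, ¬ p ∣ u + t).card ≤
      ((Finset.range L).filter fun t => (u + t).Coprime m).card +
        e * entry mx (ceilDiv L q) := by
    have h4 : ∀ p ∈ U, ((Finset.range L).filter fun t => (u + t).Coprime M ∧ p ∣ u + t).card ≤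
        entry mx (ceilDiv L q) := by
      intro p hp
      rw [hU, Finset.mem_filter, Nat.mem_primeFactors] at hp
      have hqp : q ≤ p := by
        rcases hfac p hp.1.1 hp.1.2.1 with h | h | h
        exacts [absurd h hp.2.1, absurd h hp.2.2, h]
      refine (card_filter_dvd_le hp.1.1.pos M u L).trans ((coprimeCount_mono M _ ?_).trans
        (hv _ ((ceilDiv_le_self hq L).trans hL) _).2)
      rw [ceilDiv_le_iff hp.1.1.pos]
      exact (le_ceilDiv_mul hq L).trans (Nat.mul_le_mul_left _ hqp)
    refine (Finset.card_le_card (t := _ ∪ U.biUnion fun p =>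
      (Finset.range L).filter fun t => (u + t).Coprime M ∧ p ∣ u + t) ?_).trans
      ((Finset.card_union_le _ _).trans (Nat.add_le_add_left
        ((Finset.card_biUnion_le_card_mul _ _ _ h4).trans (Nat.mul_le_mul_right _ hcard)) _))
    intro t ht
    simp only [Finset.mem_union, Finset.mem_filter, Finset.mem_biUnion] at ht ⊢
    by_cases hc : (u + t).Coprime m
    · exact Or.inl ⟨ht.1, hc⟩
    · obtain ⟨p, hp, hpu, hpm⟩ := Nat.Prime.not_coprime_iff_dvd.1 hc
      refine Or.inr ⟨p, ?_, ht.1, ht.2.1, hpu⟩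
      rw [hU, Finset.mem_filter, Nat.mem_primeFactors]
      exact ⟨⟨hp, hpm, hm⟩, fun hpM => Nat.Prime.not_coprime_iff_dvd.2 ⟨p, hp, hpu, hpM⟩ ht.2.1,
        fun hpr => ht.2.2 p hpr hpu⟩
  obtain ⟨s, hs, t, ht, hst⟩ := Finset.one_lt_card.1 (show 1 <
    ((Finset.range L).filter fun t => (u + t).Coprime m).card by omega)
  rw [Finset.mem_filter, Finset.mem_range] at hs ht
  rcases Nat.lt_or_gt_of_ne hst with h | h
  exacts [⟨s, t, h, ht.1, hs.2, ht.2⟩, ⟨t, s, h, hs.1, ht.2, hs.2⟩]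

/-- `x` times the product of the first `n` members of `l`, or `0` if `l` is too short. -/
noncomputable def takeProd (l : List ℕ) : ℕ → ℕ → ℕ :=
  List.rec (fun n x => Nat.rec x (fun _ _ => 0) n)
    (fun p _ ih n x => Nat.rec x (fun m _ => ih m (Nat.mul x p)) n) l

/-- Try to refute `16 * T ≤ (16 * N + f) * m` for `K₁ ≤ m ≤ K₂`. -/
noncomputable def cellTest (K₁ K₂ nd mn mx N f b q : ℕ) (rest av : List ℕ) : Bool :=
  Bool.rec false (force (takeProd av (entry5 nd N) 1) fun P =>
  force (Nat.div (Nat.sub (Nat.div (Nat.mul (Nat.sub 16 f) K₁) 16) 100) P) fun L₀ =>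
  Bool.rec (
   force (Bool.rec 150 L₀ (Nat.ble L₀ 150)) fun L =>
    Nat.ble (Nat.add 2 (kills mx L rest
        (Nat.mul (expo q 40 (Nat.div K₂ b)) (entry mx (ceilDiv L q)))))
    (entry mn L)) false (Nat.ble L₀ 1)) (Nat.ble N 19)

/-- Try to refute `16 * T ≤ n * m` for `K₁ ≤ m ≤ K₂`. -/
noncomputable def leafTest (K₁ K₂ nd mn mx n b q : ℕ) (rest av : List ℕ) : Bool :=
  or (cellTest K₁ K₂ nd mn mx (Nat.div n 16) (Nat.mod n 16) b q rest av)
    (cellTest K₁ K₂ nd mn mx (Nat.succ (Nat.div n 16)) 0 b q rest av)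

lemma boolRec_eq_true {x y b : Bool} (h : Bool.rec x y b = true) :
    b = false ∧ x = true ∨ b = true ∧ y = true := by
  cases b
  exacts [Or.inl ⟨rfl, h⟩, Or.inr ⟨rfl, h⟩]

lemma takeProd_eq {l : List ℕ} {n x : ℕ} (h : takeProd l n x ≠ 0) :
    n ≤ l.length ∧ takeProd l n x = x * (l.take n).prod := by
  induction l generalizing n x with
  | nil =>
    obtain _ | n := n
    · exact ⟨le_rfl, (mul_one x).symm⟩
    · exact absurd rfl h
  | cons p l ih =>
    obtain _ | n := n
    · exact ⟨Nat.zero_le _, (mul_one x).symm⟩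
    · obtain ⟨h1, h2⟩ := ih (n := n) (x := x * p) h
      refine ⟨Nat.succ_le_succ h1, ?_⟩
      rw [List.take_succ_cons, List.prod_cons, ← mul_assoc, ← h2]
      rfl

/-- The members of `rest`, together with the prime factors of `M`, are known prime factors of `m`,
and those of `av` are known not to divide `m`. -/
structure Branch (m M b : ℕ) (rest av : List ℕ) : Prop where
  eq : b = M * rest.prod
  dvd : b ∣ m
  prime_rest : ∀ p ∈ rest, p.Prime
  prime_av : ∀ p ∈ av, p.Prime ∧ ¬ p ∣ m ∧ p < 100
  nodup : av.Nodup

/-- The parts of the setting that do not change along the search. -/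
structure Setting (m T K₁ K₂ M nd mn mx : ℕ) (small : List ℕ) : Prop where
  saturated : Saturated m T
  le_left : K₁ ≤ m
  le_right : m ≤ K₂
  pos : 0 < m
  lt : m < 2 ^ 40
  cover : CoverValid nd small
  table : TableValid M mn mx

lemma Branch.card_filter_le {m M b q K₂ : ℕ} {rest av : List ℕ} (h : Branch m M b rest av)
    (hm : 0 < m) (hK : m ≤ K₂) (hm' : m < 2 ^ 40) (hq : 2 ≤ q)
    (hfac : ∀ p, p.Prime → p ∣ m → p ∣ M ∨ p ∈ rest ∨ q ≤ p) :
    (m.primeFactors.filter fun p => ¬ p ∣ M ∧ p ∉ rest).card ≤ expo q 40 (K₂ / b) := by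
  set U := m.primeFactors.filter fun p => ¬ p ∣ M ∧ p ∉ rest with hU
  have hUp : ∀ p ∈ U, p.Prime ∧ p ∣ m ∧ ¬ p ∣ M ∧ p ∉ rest ∧ q ≤ p := by
    intro p hp
    rw [hU, Finset.mem_filter, Nat.mem_primeFactors] at hp
    refine ⟨hp.1.1, hp.1.2.1, hp.2.1, hp.2.2, ?_⟩
    rcases hfac p hp.1.1 hp.1.2.1 with h | h | h
    exacts [absurd h hp.2.1, absurd h hp.2.2, h]
  have hb : 0 < b := Nat.pos_of_dvd_of_pos h.dvd hm
  have hpow : q ^ U.card ≤ ∏ p ∈ U, p :=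
    Finset.pow_card_le_prod _ _ _ fun p hp => (hUp p hp).2.2.2.2
  have hdvd : ∏ p ∈ U, p ∣ m :=
    (Finset.prod_dvd_prod_of_subset _ _ _ (Finset.filter_subset _ _)).trans
      (Nat.prod_primeFactors_dvd m)
  have hcop : (∏ p ∈ U, p).Coprime b := by
    refine Nat.Coprime.prod_left fun p hp => ?_
    obtain ⟨hp1, -, hp3, hp4, -⟩ := hUp p hp
    rw [hp1.coprime_iff_not_dvd, h.eq, hp1.dvd_mul, hp1.prime.dvd_prod_iff]
    rintro (h' | ⟨r, hr, hpr⟩)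
    · exact hp3 h'
    · rw [Nat.prime_dvd_prime_iff_eq hp1 (h.prime_rest r hr)] at hpr
      exact hp4 (hpr ▸ hr)
  have hle := Nat.le_of_dvd hm (hcop.mul_dvd_of_dvd_of_dvd hdvd h.dvd)
  refine le_expo (by omega) ?_ ?_
  · by_contra! hlt
    have h1 : 2 ^ 40 ≤ q ^ U.card :=
      (Nat.pow_le_pow_right (by norm_num) hlt.le).trans (Nat.pow_le_pow_left hq _)
    have h2 := Nat.le_of_dvd hm hdvd
    omega
  · rw [Nat.le_div_iff_mul_le hb]
    exact (Nat.mul_le_mul_right _ hpow).trans (hle.trans hK)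

lemma Setting.false_of_cellTest {m T K₁ K₂ M nd mn mx N f b q : ℕ} {small ps rest : List ℕ}
    (hs : Setting m T K₁ K₂ M nd mn mx small) (h : Branch m M b rest (small ++ ps)) (hq : 2 ≤ q)
    (hfac : ∀ p, p.Prime → p ∣ m → p ∣ M ∨ p ∈ rest ∨ q ≤ p)
    (hf : f < 16) (hT : 16 * T ≤ (16 * N + f) * m)
    (htest : cellTest K₁ K₂ nd mn mx N f b q rest (small ++ ps) = true) : False := by
  obtain ⟨hN, h1⟩ | ⟨hN, h1⟩ := boolRec_eq_true htest
  · exact absurd h1 (by simp)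
  rw [force_eq, force_eq] at h1
  obtain ⟨hL₀, h1⟩ | ⟨hL₀, h1⟩ := boolRec_eq_true h1
  swap
  · exact absurd h1 (by simp)
  rw [force_eq, Nat.ble_eq] at h1
  set P := takeProd (small ++ ps) (entry5 nd N) 1 with hP
  set L₀ := Nat.div (Nat.sub (Nat.div (Nat.mul (Nat.sub 16 f) K₁) 16) 100) P with hL₀'
  set L : ℕ := Bool.rec 150 L₀ (Nat.ble L₀ 150) with hL
  have hL₀1 : 1 < L₀ := by
    by_contra! hle
    rw [Nat.ble_eq_true_of_le hle] at hL₀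
    simp at hL₀
  have hLL₀ : L ≤ 150 ∧ L ≤ L₀ := by
    rw [hL]
    by_cases hle : L₀ ≤ 150
    · rw [Nat.ble_eq_true_of_le hle]
      exact ⟨hle, le_rfl⟩
    · have : Nat.ble L₀ 150 = false := by
        rw [← Bool.not_eq_true, Nat.ble_eq]
        exact hle
      rw [this]
      exact ⟨le_rfl, (not_le.1 hle).le⟩
  have hdiv : L₀ = ((16 - f) * K₁ / 16 - 100) / P := rfl
  have hP0 : P ≠ 0 := by
    intro h0
    rw [h0, Nat.div_zero] at hdiv
    omega
  obtain ⟨hlen, hPeq⟩ := takeProd_eq hP0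
  rw [one_mul] at hPeq
  have hLP : L * P ≤ (16 - f) * K₁ / 16 - 100 :=
    (Nat.mul_le_mul_right P hLL₀.2).trans (hdiv ▸ Nat.div_mul_le_self _ P)
  have hpos : 0 < (16 - f) * K₁ / 16 - 100 := by
    by_contra! h0
    rw [Nat.le_zero.1 h0, Nat.zero_div] at hdiv
    omega
  have hK : (16 - f) * K₁ / 16 ≤ (16 - f) * m / 16 :=
    Nat.div_le_div_right (Nat.mul_le_mul_left _ hs.le_left)
  have hfm : f * m + (16 - f) * m = 16 * m := by
    rw [← add_mul, Nat.add_sub_cancel' hf.le]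
  refine hs.saturated.false_of_covers (N := N) (L := L) (lo := f * m / 16 + 100)
    (ps := (small ++ ps).take (entry5 nd N)) ?_ (h.nodup.sublist (List.take_sublist _ _))
    (hs.cover N (by simpa using hN) ps h.nodup hlen) ?_ ?_ ?_
  · intro p hp
    obtain ⟨hp1, hp2, hp3⟩ := h.prime_av p (List.mem_of_mem_take hp)
    exact ⟨hp1, hp2, by omega⟩
  · rw [add_mul, mul_assoc] at hT
    omega
  · rw [← hPeq, ← hP]
    omega
  · exact twoCoprime_of_kills hs.pos.ne' (by omega) hs.table hLL₀.1
      (fun p hp => (h.prime_rest p hp).pos) hfac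
      (h.card_filter_le hs.pos hs.le_right hs.lt hq hfac) h1

lemma Setting.false_of_leafTest {m T K₁ K₂ M nd mn mx n b q : ℕ} {small ps rest : List ℕ}
    (hs : Setting m T K₁ K₂ M nd mn mx small) (h : Branch m M b rest (small ++ ps)) (hq : 2 ≤ q)
    (hfac : ∀ p, p.Prime → p ∣ m → p ∣ M ∨ p ∈ rest ∨ q ≤ p) (hT : 16 * T ≤ n * m)
    (htest : leafTest K₁ K₂ nd mn mx n b q rest (small ++ ps) = true) : False := by
  rw [leafTest, Bool.or_eq_true] at htest
  rcases htest with htest | htest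
  · refine hs.false_of_cellTest h hq hfac (Nat.mod_lt n (by norm_num)) ?_ htest
    have : 16 * n.div 16 + n % 16 = n := Nat.div_add_mod n 16
    rwa [this]
  · refine hs.false_of_cellTest h hq hfac (by norm_num) (hT.trans (Nat.mul_le_mul_right _ ?_)) htest
    have : n.div 16 = n / 16 := rfl
    omega

/-- Drop the pairs `(n, t)` at the start of `l` with `a / b ≤ t / D`, and continue with the last
such `n`. -/
noncomputable def advance (D a b : ℕ) (k : ℕ → List (ℕ × ℕ) → Bool) (l : List (ℕ × ℕ)) :
    ℕ → Bool :=
  List.rec (fun n => k n []) (fun x l ih n =>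
    Bool.rec (k n (x :: l)) (ih x.1) (Nat.ble (Nat.mul a D) (Nat.mul x.2 b))) l

/-- Try to refute `16 * T ≤ n * m` for `K₁ ≤ m ≤ K₂` by distinguishing which members of `l`
divide `m`. Here `b` is the product of the known prime factors of `m` and `a` its totient. -/
noncomputable def tree (K₁ K₂ nd mn mx D : ℕ) (l : List ℕ) :
    ℕ → ℕ → List ℕ → List ℕ → ℕ → List (ℕ × ℕ) → Bool :=
  List.rec (fun _ _ _ _ _ _ => false) (fun q _ ih a b rest av n th =>
    Bool.rec (Bool.rec
       (Bool.rec false (ih a b rest (av ++ [q]) n th)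
         (force (Nat.mul b q) fun b' => force (Nat.mul a (Nat.pred q)) fun a' =>
        advance D a' b' (fun n' th' => ih a' b' (q :: rest) av n' th') th n))
      true (leafTest K₁ K₂ nd mn mx n b q rest av))
    true (Nat.blt K₂ b)) l

lemma totient_mul_le_totient_mul (b c : ℕ) : (b * c).totient ≤ b.totient * c := by
  induction c using Nat.recOnMul generalizing b with
  | zero => simp
  | one => simp
  | prime p hp =>
    by_cases h : p ∣ b
    · rw [mul_comm b, Nat.totient_mul_of_prime_of_dvd hp h, mul_comm]
    · rw [mul_comm b, Nat.totient_mul_of_prime_of_not_dvd hp h, mul_comm]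
      exact Nat.mul_le_mul_left _ (Nat.sub_le _ _)
  | mul x y hx hy =>
    rw [← mul_assoc, ← mul_assoc]
    exact (hy _).trans (Nat.mul_le_mul_right _ (hx b))

lemma totient_mul_le_of_dvd {b m : ℕ} (h : b ∣ m) : m.totient * b ≤ b.totient * m := by
  obtain ⟨c, rfl⟩ := h
  calc (b * c).totient * b ≤ b.totient * c * b :=
        Nat.mul_le_mul_right _ (totient_mul_le_totient_mul b c)
    _ = b.totient * (b * c) := by ring

/-- Each pair `(n, t)` in `l` stands for a valid implication. -/
def ThresholdsValid (m T D : ℕ) (l : List (ℕ × ℕ)) : Prop :=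
  ∀ x ∈ l, m.totient * D ≤ x.2 * m → 16 * T ≤ x.1 * m

lemma ThresholdsValid.le {m T D b : ℕ} {l : List (ℕ × ℕ)} (h : ThresholdsValid m T D l)
    (hm : 0 < m) (hb : b ∣ m) {x : ℕ × ℕ} (hx : x ∈ l)
    (hle : Nat.ble (Nat.mul b.totient D) (Nat.mul x.2 b) = true) : 16 * T ≤ x.1 * m := by
  have hle' : b.totient * D ≤ x.2 * b := by simpa using hle
  refine h x hx (Nat.le_of_mul_le_mul_right (?_ : _ * b ≤ _ * b) (Nat.pos_of_dvd_of_pos hb hm))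
  calc m.totient * D * b = m.totient * b * D := by ring
    _ ≤ b.totient * m * D := Nat.mul_le_mul_right _ (totient_mul_le_of_dvd hb)
    _ = b.totient * D * m := by ring
    _ ≤ x.2 * b * m := Nat.mul_le_mul_right _ hle'
    _ = x.2 * m * b := by ring

lemma ThresholdsValid.exists_of_advance {m T D b n : ℕ} {l : List (ℕ × ℕ)}
    (h : ThresholdsValid m T D l) (hm : 0 < m) (hb : b ∣ m) (hn : 16 * T ≤ n * m)
    {k : ℕ → List (ℕ × ℕ) → Bool} (hk : advance D b.totient b k l n = true) :
    ∃ n' l', 16 * T ≤ n' * m ∧ ThresholdsValid m T D l' ∧ k n' l' = true := by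
  induction l generalizing n with
  | nil => exact ⟨n, [], hn, h, hk⟩
  | cons x l ih =>
    obtain ⟨-, h2⟩ | ⟨h1, h2⟩ := boolRec_eq_true hk
    · exact ⟨n, x :: l, hn, h, h2⟩
    · exact ih (fun y hy => h y (List.mem_cons_of_mem _ hy)) (h.le hm hb (by simp) h1) h2

lemma Branch.cons {m M b q : ℕ} {rest av : List ℕ} (h : Branch m M b rest av) (hq : q.Prime)
    (hqm : q ∣ m) (hqb : q.Coprime b) : Branch m M (b * q) (q :: rest) av where
  eq := by rw [h.eq, List.prod_cons, mul_assoc, mul_comm q]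
  dvd := hqb.symm.mul_dvd_of_dvd_of_dvd h.dvd hqm
  prime_rest := List.forall_mem_cons.2 ⟨hq, h.prime_rest⟩
  prime_av := h.prime_av
  nodup := h.nodup

lemma Branch.append {m M b q : ℕ} {rest av : List ℕ} (h : Branch m M b rest av) (hq : q.Prime)
    (hqm : ¬ q ∣ m) (hq' : q < 100) (hqa : q ∉ av) : Branch m M b rest (av ++ [q]) where
  eq := h.eq
  dvd := h.dvd
  prime_rest := h.prime_rest
  prime_av := by
    intro p hp
    rcases List.mem_append.1 hp with hp | hp
    · exact h.prime_av p hp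
    · rw [List.mem_singleton.1 hp]
      exact ⟨hq, hqm, hq'⟩
  nodup := h.nodup.append (List.nodup_singleton q) (by simpa using hqa)

lemma Branch.coprime {m M b q : ℕ} {rest av : List ℕ} (h : Branch m M b rest av) (hq : q.Prime)
    (hqM : ¬ q ∣ M) (hqr : q ∉ rest) : q.Coprime b := by
  rw [hq.coprime_iff_not_dvd, h.eq, hq.dvd_mul, hq.prime.dvd_prod_iff]
  rintro (h' | ⟨r, hr, hqr'⟩)
  · exact hqM h'
  · rw [Nat.prime_dvd_prime_iff_eq hq (h.prime_rest r hr)] at hqr'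
    exact hqr (hqr' ▸ hr)

theorem Setting.false_of_tree {m T K₁ K₂ M nd mn mx D n b : ℕ} {small ps rest l : List ℕ}
    {th : List (ℕ × ℕ)} (hs : Setting m T K₁ K₂ M nd mn mx small)
    (h : Branch m M b rest (small ++ ps)) (hlt : l.Pairwise (· < ·))
    (hl : ∀ q ∈ l, q.Prime ∧ ¬ q ∣ M ∧ q < 72 ∧ (∀ p ∈ rest, p < q) ∧ ∀ p ∈ small ++ ps, p < q)
    (hfac : ∀ p, p.Prime → p ∣ m → p ∣ M ∨ p ∈ rest ∨ p ∈ l ∨ 72 ≤ p)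
    (hT : 16 * T ≤ n * m) (hth : ThresholdsValid m T D th)
    (htest : tree K₁ K₂ nd mn mx D l b.totient b rest (small ++ ps) n th = true) : False := by
  induction l generalizing b ps rest n th with
  | nil => exact absurd htest (by simp [tree])
  | cons q l ih =>
    obtain ⟨⟨hq, hqM, hq72, hqr, hqa⟩, hl⟩ := List.forall_mem_cons.1 hl
    obtain ⟨hql, hlt⟩ := List.pairwise_cons.1 hlt
    obtain ⟨-, h1⟩ | ⟨h1, -⟩ := boolRec_eq_true htest
    swap
    · have h2 : K₂ < b := by simpa [Nat.blt_eq] using h1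
      exact absurd (Nat.le_of_dvd hs.pos h.dvd) (not_le.2 (hs.le_right.trans_lt h2))
    obtain ⟨-, h1⟩ | ⟨h1, -⟩ := boolRec_eq_true h1
    swap
    · refine hs.false_of_leafTest h hq.two_le (fun p hp hpm => ?_) hT h1
      rcases hfac p hp hpm with h | h | h | h
      · exact Or.inl h
      · exact Or.inr (Or.inl h)
      · rcases List.mem_cons.1 h with rfl | h
        exacts [Or.inr (Or.inr le_rfl), Or.inr (Or.inr (hql p h).le)]
      · exact Or.inr (Or.inr (hq72.le.trans h))
    obtain ⟨-, h1⟩ | ⟨h1, h2⟩ := boolRec_eq_true h1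
    · exact absurd h1 (by simp)
    by_cases hqm : q ∣ m
    · have hqr' : q ∉ rest := fun hmem => (hqr q hmem).false
      have hcop := h.coprime hq hqM hqr'
      have h' := h.cons hq hqm hcop
      rw [force_eq, force_eq] at h1
      have e : Nat.mul b.totient q.pred = (b * q).totient := by
        rw [Nat.totient_mul hcop.symm, Nat.totient_prime hq]
        rfl
      rw [e] at h1
      obtain ⟨n', th', hT', hth', h3⟩ := hth.exists_of_advance hs.pos h'.dvd hT h1
      refine ih h' hlt (fun r hr => ?_) (fun p hp hpm => ?_) hT' hth' h3
      · obtain ⟨hr1, hr2, hr3, hr4, hr5⟩ := hl r hr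
        exact ⟨hr1, hr2, hr3, List.forall_mem_cons.2 ⟨hql r hr, hr4⟩, hr5⟩
      · have := hfac p hp hpm
        simp only [List.mem_cons] at this ⊢
        tauto
    · have h' := h.append hq hqm (by omega) fun hmem => (hqa q hmem).false
      rw [List.append_assoc] at h' h2
      refine ih h' hlt (fun r hr => ?_) (fun p hp hpm => ?_) hT hth h2
      · obtain ⟨hr1, hr2, hr3, hr4, hr5⟩ := hl r hr
        refine ⟨hr1, hr2, hr3, hr4, fun p hp => ?_⟩
        rw [← List.append_assoc] at hp
        rcases List.mem_append.1 hp with hp | hp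
        exacts [hr5 p hp, List.mem_singleton.1 hp ▸ hql r hr]
      · have := hfac p hp hpm
        have hne : p ≠ q := fun e => hqm (e ▸ hpm)
        simp only [List.mem_cons, hne, false_or] at this
        exact this

/-- Begin with the first pair `(n, t)` for which `a / b ≤ t / D` is required, and advance. -/
noncomputable def start (D a b : ℕ) : List (ℕ × ℕ) → (ℕ → List (ℕ × ℕ) → Bool) → Bool
  | [], _ => false
  | (n, t) :: l, k => cond (Nat.ble (Nat.mul a D) (Nat.mul t b)) (advance D a b k l n) false

/-- Those of `11, 13` that are selected. -/
noncomputable def restBase (d₁₁ d₁₃ : Bool) : List ℕ :=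
  cond d₁₁ (cond d₁₃ [11, 13] [11]) (cond d₁₃ [13] [])

/-- The search, for numbers `m` whose prime factors below `17` are the selected ones and `2`. -/
noncomputable def config (K₁ K₂ D : ℕ) (th : List (ℕ × ℕ)) (ps : List ℕ)
    (d₃ d₅ d₇ d₁₁ d₁₃ : Bool) : Bool :=
  force (coverTable d₃ d₅ d₇ d₁₁ d₁₃) fun nd =>
  force (minTable d₃ d₅ d₇) fun mn =>
  force (maxTable d₃ d₅ d₇) fun mx =>
  force (mulIf d₃ 3 (mulIf d₅ 5 (mulIf d₇ 7 (mulIf d₁₁ 11 (mulIf d₁₃ 13 2))))) fun b =>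
  force (mulIf d₃ 2 (mulIf d₅ 4 (mulIf d₇ 6 (mulIf d₁₁ 10 (mulIf d₁₃ 12 1))))) fun a =>
  start D a b th fun n' th' =>
    tree K₁ K₂ nd mn mx D ps a b (restBase d₁₁ d₁₃) (smallCand d₃ d₅ d₇ d₁₁ d₁₃) n' th'

/-- The search, for all sets of small prime factors. -/
noncomputable def allConfigs (K₁ K₂ D : ℕ) (th : List (ℕ × ℕ)) (ps : List ℕ) : Bool :=
  both fun d₃ => both fun d₅ => both fun d₇ => both fun d₁₁ => both fun d₁₃ =>
    config K₁ K₂ D th ps d₃ d₅ d₇ d₁₁ d₁₃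

/-- Compute pairs `(n, t)`, one for each value of the second argument. -/
noncomputable def thresholds (K₁ K₂ : ℕ) (k : List (ℕ × ℕ) → Bool) (j : ℕ) :
    ℕ → ℕ → List (ℕ × ℕ) → Bool :=
  Nat.rec (fun _ _ l => k l) (fun _ ih n m l =>
    Bool.rec (ih n (Nat.succ m) l)
      (force (threshold K₁ n (Nat.mul 108304247 m)) fun t => ih (Nat.succ n) m ((n, t) :: l))
      (Nat.ble (Nat.pow (Nat.mul n K₂) 64) (Nat.pow 2 (Nat.add 256 m)))) j

/-- The primes between `17` and `71`. -/
def midPrimes : List ℕ := [17, 19, 23, 29, 31, 37, 41, 43, 47, 53, 59, 61, 67, 71]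

/-- Refute all `m` with `K₁ ≤ m ≤ K₂`, where the bounds for `T` come from `threshold`. -/
noncomputable def rangeTest (K₁ K₂ m : ℕ) : Bool :=
  thresholds K₁ K₂ (fun l => allConfigs K₁ K₂ 1099511627776 l midPrimes) 400 60 m []

lemma ThresholdsValid.exists_of_start {m T D b : ℕ} {l : List (ℕ × ℕ)}
    (h : ThresholdsValid m T D l) (hm : 0 < m) (hb : b ∣ m)
    {k : ℕ → List (ℕ × ℕ) → Bool} (hk : start D b.totient b l k = true) :
    ∃ n' l', 16 * T ≤ n' * m ∧ ThresholdsValid m T D l' ∧ k n' l' = true := by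
  obtain _ | ⟨⟨n, t⟩, l⟩ := l
  · exact absurd hk (by simp [start])
  · rw [start, Bool.cond_false_right, Bool.and_eq_true] at hk
    exact ThresholdsValid.exists_of_advance (fun y hy => h y (List.mem_cons_of_mem _ hy)) hm hb
      (h.le hm hb (x := (n, t)) (by simp) hk.1) hk.2

lemma coprime_mulIf {d : Bool} {p q x : ℕ} (hp : q.Coprime p) (hx : q.Coprime x) :
    q.Coprime (mulIf d p x) := by
  cases d
  exacts [hx, hp.mul_right hx]

lemma mulIf_dvd {d : Bool} {p x m : ℕ} (hp : d = true → p ∣ m) (hx : x ∣ m)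
    (hpx : p.Coprime x) : mulIf d p x ∣ m := by
  cases d
  exacts [hx, hpx.mul_dvd_of_dvd_of_dvd (hp rfl) hx]

lemma totient_mulIf {p x : ℕ} (d : Bool) (hp : p.Prime) (hpx : p.Coprime x) :
    (mulIf d p x).totient = mulIf d (p - 1) x.totient := by
  cases d
  · rfl
  · exact (Nat.totient_mul hpx).trans (by rw [Nat.totient_prime hp]; rfl)

lemma prime_of_mem_midPrimes : ∀ q ∈ midPrimes, q.Prime := by
  simp only [midPrimes, List.forall_mem_cons]
  norm_num

lemma midPrimes_spec (d₃ d₅ d₇ d₁₁ d₁₃ : Bool) : ∀ q ∈ midPrimes,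
    ¬ q ∣ baseModulus d₃ d₅ d₇ ∧ q < 72 ∧ (∀ p ∈ restBase d₁₁ d₁₃, p < q) ∧
    ∀ p ∈ smallCand d₃ d₅ d₇ d₁₁ d₁₃, p < q := by
  revert d₃ d₅ d₇ d₁₁ d₁₃
  decide +kernel

lemma mem_smallCand {d₃ d₅ d₇ d₁₁ d₁₃ : Bool} {p : ℕ} : p ∈ smallCand d₃ d₅ d₇ d₁₁ d₁₃ ↔
    (d₃ = false ∧ p = 3) ∨ (d₅ = false ∧ p = 5) ∨ (d₇ = false ∧ p = 7) ∨
    (d₁₁ = false ∧ p = 11) ∨ (d₁₃ = false ∧ p = 13) := by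
  cases d₃ <;> cases d₅ <;> cases d₇ <;> cases d₁₁ <;> cases d₁₃ <;> simp [smallCand, cand]

lemma prime_of_mem_restBase {d₁₁ d₁₃ : Bool} : ∀ p ∈ restBase d₁₁ d₁₃, p.Prime := by
  cases d₁₁ <;> cases d₁₃ <;> simp [restBase] <;> norm_num

lemma mulIf_eq_baseModulus_mul (d₃ d₅ d₇ d₁₁ d₁₃ : Bool) :
    mulIf d₃ 3 (mulIf d₅ 5 (mulIf d₇ 7 (mulIf d₁₁ 11 (mulIf d₁₃ 13 2)))) =
      baseModulus d₃ d₅ d₇ * (restBase d₁₁ d₁₃).prod := by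
  revert d₃ d₅ d₇ d₁₁ d₁₃
  decide +kernel

lemma nodup_smallCand (d₃ d₅ d₇ d₁₁ d₁₃ : Bool) : (smallCand d₃ d₅ d₇ d₁₁ d₁₃).Nodup := by
  revert d₃ d₅ d₇ d₁₁ d₁₃
  decide +kernel

lemma mem_of_prime_of_lt {p : ℕ} (hp : p.Prime) (h : p < 72) :
    p = 2 ∨ p = 3 ∨ p = 5 ∨ p = 7 ∨ p = 11 ∨ p = 13 ∨ p ∈ midPrimes := by
  have key : ∀ p < 72, (p = 2 ∨ p = 3 ∨ p = 5 ∨ p = 7 ∨ p = 11 ∨ p = 13 ∨ p ∈ midPrimes) ∨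
      p < 2 ∨ ∃ d ∈ [2, 3, 5, 7], d ∣ p ∧ d < p := by
    decide +kernel
  rcases key p h with h1 | h1 | ⟨d, hd, hdp, hlt⟩
  · exact h1
  · exact absurd hp.two_le (not_le.2 h1)
  · rcases (Nat.dvd_prime hp).1 hdp with rfl | rfl
    exacts [absurd hd (by decide), absurd rfl hlt.ne]

theorem Saturated.false_of_allConfigs {m T K₁ K₂ D : ℕ} {th : List (ℕ × ℕ)} (h : Saturated m T)
    (hm : 0 < m) (hm₁ : K₁ ≤ m) (hm₂ : m ≤ K₂) (hm₃ : m < 2 ^ 40) (hth : ThresholdsValid m T D th)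
    (htest : allConfigs K₁ K₂ D th midPrimes = true) : False := by
  obtain ⟨d₃, h₃⟩ : ∃ d : Bool, d = true ↔ 3 ∣ m := ⟨decide (3 ∣ m), decide_eq_true_iff⟩
  obtain ⟨d₅, h₅⟩ : ∃ d : Bool, d = true ↔ 5 ∣ m := ⟨decide (5 ∣ m), decide_eq_true_iff⟩
  obtain ⟨d₇, h₇⟩ : ∃ d : Bool, d = true ↔ 7 ∣ m := ⟨decide (7 ∣ m), decide_eq_true_iff⟩
  obtain ⟨d₁₁, h₁₁⟩ : ∃ d : Bool, d = true ↔ 11 ∣ m := ⟨decide (11 ∣ m), decide_eq_true_iff⟩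
  obtain ⟨d₁₃, h₁₃⟩ : ∃ d : Bool, d = true ↔ 13 ∣ m := ⟨decide (13 ∣ m), decide_eq_true_iff⟩
  have h1 : config K₁ K₂ D th midPrimes d₃ d₅ d₇ d₁₁ d₁₃ = true :=
    both_eq_true (both_eq_true (both_eq_true (both_eq_true (both_eq_true htest d₃) d₅) d₇) d₁₁) d₁₃
  simp only [config, force_eq] at h1
  have e₁₃ : Nat.Coprime 13 2 := by norm_num
  have e₁₁ : Nat.Coprime 11 (mulIf d₁₃ 13 2) := coprime_mulIf (by norm_num) (by norm_num)
  have e₇ : Nat.Coprime 7 (mulIf d₁₁ 11 (mulIf d₁₃ 13 2)) :=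
    coprime_mulIf (by norm_num) (coprime_mulIf (by norm_num) (by norm_num))
  have e₅ : Nat.Coprime 5 (mulIf d₇ 7 (mulIf d₁₁ 11 (mulIf d₁₃ 13 2))) :=
    coprime_mulIf (by norm_num) (coprime_mulIf (by norm_num)
      (coprime_mulIf (by norm_num) (by norm_num)))
  have e₃ : Nat.Coprime 3 (mulIf d₅ 5 (mulIf d₇ 7 (mulIf d₁₁ 11 (mulIf d₁₃ 13 2)))) :=
    coprime_mulIf (by norm_num) (coprime_mulIf (by norm_num) (coprime_mulIf (by norm_num)
      (coprime_mulIf (by norm_num) (by norm_num))))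
  set b := mulIf d₃ 3 (mulIf d₅ 5 (mulIf d₇ 7 (mulIf d₁₁ 11 (mulIf d₁₃ 13 2)))) with hb
  have ha : mulIf d₃ 2 (mulIf d₅ 4 (mulIf d₇ 6 (mulIf d₁₁ 10 (mulIf d₁₃ 12 1)))) = b.totient := by
    rw [hb, totient_mulIf _ Nat.prime_three e₃, totient_mulIf _ Nat.prime_five e₅,
      totient_mulIf _ (by norm_num) e₇, totient_mulIf _ (by norm_num) e₁₁,
      totient_mulIf _ (by norm_num) e₁₃, Nat.totient_two]
  have hbm : b ∣ m := mulIf_dvd h₃.1 (mulIf_dvd h₅.1 (mulIf_dvd h₇.1 (mulIf_dvd h₁₁.1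
    (mulIf_dvd h₁₃.1 h.even e₁₃) e₁₁) e₇) e₅) e₃
  rw [ha] at h1
  obtain ⟨n', th', hT, hth', h2⟩ := hth.exists_of_start hm hbm h1
  have hs : Setting m T K₁ K₂ (baseModulus d₃ d₅ d₇) (coverTable d₃ d₅ d₇ d₁₁ d₁₃)
      (minTable d₃ d₅ d₇) (maxTable d₃ d₅ d₇) (smallCand d₃ d₅ d₇ d₁₁ d₁₃) :=
    ⟨h, hm₁, hm₂, hm, hm₃, coverValid_coverTable _ _ _ _ _, tableValid_minTable_maxTable _ _ _⟩
  have hbr : Branch m (baseModulus d₃ d₅ d₇) b (restBase d₁₁ d₁₃)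
      (smallCand d₃ d₅ d₇ d₁₁ d₁₃ ++ []) := by
    rw [List.append_nil]
    refine ⟨?_, hbm, ?_, ?_, nodup_smallCand _ _ _ _ _⟩
    · exact mulIf_eq_baseModulus_mul _ _ _ _ _
    · exact prime_of_mem_restBase
    · intro p hp
      rcases mem_smallCand.1 hp with ⟨hd, rfl⟩ | ⟨hd, rfl⟩ | ⟨hd, rfl⟩ | ⟨hd, rfl⟩ | ⟨hd, rfl⟩ <;>
        refine ⟨by norm_num, ?_, by norm_num⟩ <;> simp_all
  refine hs.false_of_tree (ps := []) (l := midPrimes) hbr (by decide) ?_ ?_ hT hth'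
    (by rwa [List.append_nil])
  · rw [List.append_nil]
    exact fun q hq => ⟨prime_of_mem_midPrimes q hq, midPrimes_spec _ _ _ _ _ q hq⟩
  · intro p hp hpm
    by_cases hp72 : 72 ≤ p
    · exact Or.inr (Or.inr (Or.inr hp72))
    rcases mem_of_prime_of_lt hp (not_le.1 hp72) with rfl | rfl | rfl | rfl | rfl | rfl | hmem
    · left; cases d₃ <;> cases d₅ <;> cases d₇ <;> decide
    · left; rw [h₃.2 hpm]; exact Dvd.intro _ rfl
    · left; rw [h₅.2 hpm]; cases d₃ <;> cases d₇ <;> decide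
    · left; rw [h₇.2 hpm]; cases d₃ <;> cases d₅ <;> decide
    · right; left; rw [h₁₁.2 hpm]; cases d₁₃ <;> decide
    · right; left; rw [h₁₃.2 hpm]; cases d₁₁ <;> decide
    · exact Or.inr (Or.inr (Or.inl hmem))

lemma Saturated.exists_of_thresholds {m T K₁ K₂ : ℕ} (h : Saturated m T) (hK₁ : 30000000 ≤ K₁)
    (hm₁ : K₁ ≤ m) (hm₂ : m ≤ K₂) (hm : m ≤ 2 * 10 ^ 11) {k : List (ℕ × ℕ) → Bool}
    {fuel n j : ℕ} {l : List (ℕ × ℕ)} (hn : 60 ≤ n) (hl : ThresholdsValid m T 1099511627776 l)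
    (hk : thresholds K₁ K₂ k fuel n j l = true) :
    ∃ l', ThresholdsValid m T 1099511627776 l' ∧ k l' = true := by
  induction fuel generalizing n j l with
  | zero => exact ⟨l, hl, hk⟩
  | succ fuel ih =>
    obtain ⟨-, h1⟩ | ⟨h1, h2⟩ := boolRec_eq_true hk
    · exact ih hn hl h1
    · rw [force_eq] at h2
      refine ih (by omega) (List.forall_mem_cons.2 ⟨fun ht => ?_, hl⟩) h2
      exact h.sixteen_mul_le hK₁ hm₁ hm₂ hm hn (Nat.le_of_ble_eq_true h1) ht

theorem Saturated.false_of_rangeTest {m T K₁ K₂ j : ℕ} (h : Saturated m T) (hK₁ : 30000000 ≤ K₁)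
    (hm₁ : K₁ ≤ m) (hm₂ : m ≤ K₂) (hm : m ≤ 2 * 10 ^ 11)
    (htest : rangeTest K₁ K₂ j = true) : False := by
  obtain ⟨l, hl, h1⟩ := h.exists_of_thresholds hK₁ hm₁ hm₂ hm le_rfl (by simp [ThresholdsValid])
    htest
  exact h.false_of_allConfigs (by omega) hm₁ hm₂ (by omega) hl h1

/-- Call-by-value application of `f`. -/
noncomputable def forceNat (n : ℕ) (f : ℕ → ℕ) : ℕ :=
  Nat.rec (f 0) (fun k _ => f (Nat.succ k)) n

/-- The bits `t < W` with `q ∣ 2 * (base + t) + 1` are set, for odd `q`. -/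
noncomputable def multiplesMask (base W q : ℕ) : ℕ :=
  Nat.shiftRight
    (Nat.div (Nat.sub (Nat.pow 2 (Nat.mul q (Nat.add 2 (Nat.div W q)))) 1)
      (Nat.sub (Nat.pow 2 q) 1))
    (Nat.mod (Nat.add base (Nat.div (Nat.succ q) 2)) q)

/-- The union of the masks for the `2 ^ d` numbers `q, q + 2, q + 4, …`, leaving out those that
exceed `Q` and those that exceed `73` and are not coprime to `F`. -/
noncomputable def sieveTree (base W F Q : ℕ) (d : ℕ) : ℕ → ℕ :=
  Nat.rec (fun q => forceNat q fun q =>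
      cond (Nat.ble q Q) (cond (or (Nat.ble q 73) (Nat.beq (Nat.gcd q F) 1))
        (multiplesMask base W q) 0) 0)
    (fun d ih q => Nat.lor (ih q) (ih (Nat.add q (Nat.pow 2 (Nat.succ d))))) d

/-- The numbers `a ≤ 414` for which `2 * a + 1` is prime. -/
def halvedPrimes : List ℕ :=
  [1, 2, 3, 5, 6, 8, 9, 11, 14, 15, 18, 20, 21, 23, 26, 29, 30, 33, 35, 36, 39, 41, 44, 48,
   50, 51, 53, 54, 56, 63, 65, 68, 69, 74, 75, 78, 81, 83, 86, 89, 90, 95, 96, 98, 99, 105,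
   111, 113, 114, 116, 119, 120, 125, 128, 131, 134, 135, 138, 140, 141, 146, 153, 155, 156,
   158, 165, 168, 173, 174, 176, 179, 183, 186, 189, 191, 194, 198, 200, 204, 209, 210, 215,
   216, 219, 221, 224, 228, 230, 231, 233, 239, 243, 245, 249, 251, 254, 260, 261, 270, 273,
   278, 281, 284, 285, 288, 293, 296, 299, 300, 303, 306, 308, 309, 315, 320, 321, 323, 326,
   329, 330, 336, 338, 341, 345, 350, 354, 359, 363, 366, 369, 371, 375, 378, 380, 384, 386,
   393, 398, 404, 405, 410, 411, 413, 414]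

/-- For each `m = 2 * (base + i)` with `i < len`, one of the numbers `m + (2 * a + 1)` with `a` in
`halvedPrimes` survives sieving by the primes up to `5661`. -/
noncomputable def blockTest (base len : ℕ) : Bool :=
  force (Nat.factorial 73) fun F =>
  force (sieveTree base (Nat.add len 500) F 5661 12 3) fun C =>
    Nat.beq 0 (List.rec (Nat.sub (Nat.pow 2 len) 1)
      (fun a _ ih => Nat.land (Nat.shiftRight C a) ih) halvedPrimes)

lemma forceNat_eq (n : ℕ) (f : ℕ → ℕ) : forceNat n f = f n := by
  cases n <;> rfl

lemma testBit_geomSum {q j n : ℕ} (hq : 0 < q) (hj : j < n) :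
    (∑ k ∈ Finset.range n, (2 ^ q) ^ k).testBit (q * j) = true := by
  induction n generalizing j with
  | zero => omega
  | succ n ih =>
    rw [geom_sum_succ, Nat.testBit_two_pow_mul_add _ (Nat.one_lt_two_pow hq.ne')]
    obtain _ | j := j
    · simp [hq]
    · rw [if_neg (by rw [Nat.mul_succ]; omega), Nat.mul_succ, Nat.add_sub_cancel]
      exact ih (by omega)

lemma testBit_multiplesMask {base W q t : ℕ} (hq : 2 < q) (hodd : q % 2 = 1) (ht : t < W)
    (hd : q ∣ 2 * (base + t) + 1) : (multiplesMask base W q).testBit t = true := by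
  change (((2 ^ (q * (2 + W / q)) - 1) / (2 ^ q - 1)) >>>
    ((base + (q + 1) / 2) % q)).testBit t = true
  have h2 : 2 ≤ 2 ^ q := Nat.le_self_pow (by omega) 2
  rw [pow_mul, ← Nat.geomSum_eq h2, Nat.testBit_shiftRight]
  have h3 : q ∣ (base + (q + 1) / 2) % q + t := by
    have hc : q.Coprime 2 := Nat.coprime_two_right.2 (Nat.odd_iff.2 hodd)
    refine hc.dvd_of_dvd_mul_left ?_
    have e := Nat.div_add_mod (base + (q + 1) / 2) q
    have h4 : 2 * ((base + (q + 1) / 2) % q + t) + q * (2 * ((base + (q + 1) / 2) / q)) =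
        (2 * (base + t) + 1) + q := by
      have : 2 * ((q + 1) / 2) = q + 1 := by omega
      linarith
    exact (Nat.dvd_add_left (dvd_mul_right q _)).1 (h4 ▸ hd.add dvd_rfl)
  obtain ⟨j, hj⟩ := h3
  rw [hj]
  refine testBit_geomSum (by omega) ?_
  have h5 := Nat.mod_lt (base + (q + 1) / 2) (show 0 < q by omega)
  have h6 := Nat.lt_mul_div_succ W (show 0 < q by omega)
  refine Nat.lt_of_mul_lt_mul_left (a := q) ?_
  rw [← hj]
  linarith

lemma sieveTree_zero (base W F Q q : ℕ) : sieveTree base W F Q 0 q =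
    cond (Nat.ble q Q) (cond (or (Nat.ble q 73) (Nat.beq (Nat.gcd q F) 1))
      (multiplesMask base W q) 0) 0 :=
  forceNat_eq q fun q => cond (Nat.ble q Q) (cond (or (Nat.ble q 73) (Nat.beq (Nat.gcd q F) 1))
    (multiplesMask base W q) 0) 0

lemma sieveTree_succ (base W F Q d q : ℕ) : sieveTree base W F Q (d + 1) q =
    sieveTree base W F Q d q ||| sieveTree base W F Q d (q + 2 ^ (d + 1)) :=
  rfl

lemma testBit_sieveTree {base W F Q d q i t : ℕ} (hi : i < 2 ^ d) (hQ : q + 2 * i ≤ Q)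
    (hF : q + 2 * i ≤ 73 ∨ (q + 2 * i).Coprime F)
    (ht : (multiplesMask base W (q + 2 * i)).testBit t = true) :
    (sieveTree base W F Q d q).testBit t = true := by
  induction d generalizing q i with
  | zero =>
    obtain rfl : i = 0 := by simpa using hi
    rw [mul_zero, add_zero] at *
    rw [sieveTree_zero, Nat.ble_eq_true_of_le hQ]
    have : (or (Nat.ble q 73) (Nat.beq (Nat.gcd q F) 1)) = true := by
      rw [Bool.or_eq_true]
      exact hF.imp Nat.ble_eq_true_of_le fun h => Nat.beq_eq ▸ h
    rw [this]
    exact ht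
  | succ d ih =>
    rw [sieveTree_succ, Nat.testBit_or, Bool.or_eq_true]
    rw [pow_succ] at hi ⊢
    by_cases h : i < 2 ^ d
    · exact Or.inl (ih h hQ hF ht)
    · obtain ⟨i, rfl⟩ := Nat.exists_eq_add_of_le (not_lt.1 h)
      have e : q + 2 * (2 ^ d + i) = q + 2 ^ d * 2 + 2 * i := by ring
      rw [e] at hQ hF ht
      exact Or.inr (ih (by omega) hQ hF ht)

lemma exists_testBit_eq_false {C D i : ℕ} (l : List ℕ) (hD : D.testBit i = true)
    (h : (List.rec D (fun a _ ih => Nat.land (Nat.shiftRight C a) ih) l : ℕ).testBit i = false) :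
    ∃ a ∈ l, C.testBit (a + i) = false := by
  induction l with
  | nil => exact absurd (hD.symm.trans h) (by decide)
  | cons a l ih =>
    change (C >>> a &&& (List.rec D (fun a _ ih => Nat.land (Nat.shiftRight C a) ih) l :
      ℕ)).testBit i = false at h
    rw [Nat.testBit_and, Nat.testBit_shiftRight, Bool.and_eq_false_iff] at h
    rcases h with h | h
    · exact ⟨a, by simp, h⟩
    · obtain ⟨b, hb, hb'⟩ := ih h
      exact ⟨b, List.mem_cons_of_mem _ hb, hb'⟩

lemma mem_halvedPrimes_spec : ∀ a ∈ halvedPrimes, (2 * a + 1).Prime ∧ a ≤ 414 := by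
  simp only [halvedPrimes, List.forall_mem_cons]
  norm_num

lemma exists_prime_add_of_blockTest {base len i : ℕ} (hlen : base + len ≤ 16000000) (hi : i < len)
    (htest : blockTest base len = true) :
    ∃ p, p.Prime ∧ p ≤ 829 ∧ (p + 2 * (base + i)).Prime := by
  simp only [blockTest, force_eq] at htest
  have h1 := Nat.eq_of_beq_eq_true htest
  obtain ⟨a, ha, hbit⟩ := exists_testBit_eq_false (C := sieveTree base (len + 500)
    (Nat.factorial 73) 5661 12 3) (D := 2 ^ len - 1) (i := i) halvedPrimes
    (by simp [Nat.testBit_two_pow_sub_one, hi])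
    ((congrArg (Nat.testBit · i) h1).symm.trans (Nat.zero_testBit i))
  obtain ⟨hp, ha⟩ := mem_halvedPrimes_spec a ha
  have hp2 := hp.two_le
  refine ⟨2 * a + 1, hp, by omega, ?_⟩
  by_contra hn
  set n := 2 * a + 1 + 2 * (base + i) with hn'
  have hq := Nat.minFac_prime (n := n) (by omega)
  have hqn := Nat.minFac_dvd n
  have hsq := Nat.minFac_sq_le_self (n := n) (by omega) hn
  set q := n.minFac
  have hodd : q % 2 = 1 := by
    refine hq.eq_two_or_odd.resolve_left fun h => ?_
    rw [h] at hqn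
    omega
  have h3 : 3 ≤ q := by
    have := hq.two_le
    omega
  have hq5 : q ≤ 5661 := by
    by_contra! h
    have : 5662 ^ 2 ≤ q ^ 2 := Nat.pow_le_pow_left h 2
    omega
  have e : 3 + 2 * ((q - 3) / 2) = q := by omega
  have := testBit_sieveTree (base := base) (W := len + 500) (F := Nat.factorial 73) (Q := 5661)
    (d := 12) (q := 3) (i := (q - 3) / 2) (t := a + i) (by omega) (by omega) ?_ ?_
  · exact absurd (hbit.symm.trans this) (by decide)
  · rw [e]
    refine or_iff_not_imp_left.2 fun h => (Nat.Prime.coprime_iff_not_dvd hq).2 fun hd => ?_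
    exact h ((Nat.Prime.dvd_factorial hq).1 hd)
  · rw [e]
    refine testBit_multiplesMask h3 hodd (by omega) ?_
    rwa [show 2 * (base + (a + i)) + 1 = n by omega]

lemma Saturated.lt_prime_add {m T p : ℕ} (h : Saturated m T) (hm : 0 < m) (hp : p.Prime)
    (hpm : (p + m).Prime) : T < p + m := by
  by_contra! hT
  have hd : ¬ p ∣ m := fun hd => by
    have := (Nat.prime_dvd_prime_iff_eq hp hpm).1 (Nat.dvd_add dvd_rfl hd)
    omega
  have hd' : ¬ p + m ∣ m := fun hd => by
    have := Nat.le_of_dvd hm hd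
    have := hp.pos
    omega
  have := h.inj p (p + m) hp hpm (by omega) hT hd hd' (by simp)
  omega

theorem Saturated.false_of_prime_add {m T p r : ℕ} (h : Saturated m T) (hp : p.Prime)
    (hpm : (p + m).Prime) (hpr : p ≤ r) (hr : r < m) (hc : r.Coprime m) (hne : r ≠ m / 2 + 2)
    (hnp : ¬ r.Prime) : False := by
  have hT := h.lt_prime_add (by omega) hp hpm
  obtain ⟨q, hq, hqT, rfl⟩ := h.cover r hr hc hne
  rcases Nat.lt_or_ge q m with hlt | hge
  · rw [Nat.mod_eq_of_lt hlt] at hnp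
    exact hnp hq
  · have h1 := Nat.mod_add_div q m
    have h2 : m * 1 ≤ m * (q / m) := Nat.mul_le_mul_left m (Nat.div_pos hge (by omega))
    omega

lemma exists_prime_sq_coprime {m : ℕ} (hm : 0 < m) (hlt : m < 40000000) (h2 : 2 ∣ m) :
    ∃ q, q.Prime ∧ 29 ≤ q ∧ q ≤ 43 ∧ q.Coprime m := by
  by_contra! hq
  have key : ∀ q, q.Prime → 29 ≤ q → q ≤ 43 → q ∣ m := fun q h h1 h2 =>
    not_not.1 fun hd => hq q h h1 h2 ((Nat.Prime.coprime_iff_not_dvd h).2 hd)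
  have h29 := key 29 (by norm_num) (by norm_num) (by norm_num)
  have h31 := key 31 (by norm_num) (by norm_num) (by norm_num)
  have h37 := key 37 (by norm_num) (by norm_num) (by norm_num)
  have h41 := key 41 (by norm_num) (by norm_num) (by norm_num)
  have h43 := key 43 (by norm_num) (by norm_num) (by norm_num)
  have := Nat.le_of_dvd hm (Nat.lcm_dvd h2 (Nat.lcm_dvd h29 (Nat.lcm_dvd h31 (Nat.lcm_dvd h37
    (Nat.lcm_dvd h41 h43)))))
  exact absurd (this.trans_lt hlt) (by norm_num)

theorem Saturated.false_of_blockTest {m T base len : ℕ} (h : Saturated m T) (hb : 3000 ≤ base)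
    (hlen : base + len ≤ 16000000) (hm₁ : 2 * base ≤ m) (hm₂ : m < 2 * (base + len))
    (htest : blockTest base len = true) : False := by
  obtain ⟨n, rfl⟩ := h.even
  obtain ⟨i, rfl⟩ := Nat.exists_eq_add_of_le (show base ≤ n by omega)
  obtain ⟨p, hp, hp829, hpm⟩ := exists_prime_add_of_blockTest hlen (i := i) (by omega) htest
  obtain ⟨q, hq, hq29, hq43, hqm⟩ :=
    exists_prime_sq_coprime (m := 2 * (base + i)) (by omega) (by omega) (dvd_mul_right 2 _)
  have h1 : 29 * 29 ≤ q * q := Nat.mul_le_mul hq29 hq29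
  have h2 : q * q ≤ 43 * 43 := Nat.mul_le_mul hq43 hq43
  exact h.false_of_prime_add hp hpm (r := q * q) (by omega) (by omega) (hqm.mul_left hqm) (by omega)
    (Nat.not_prime_mul hq.one_lt.ne' hq.one_lt.ne')

/-- The odd primes up to `149`. -/
def oddPrimes : List ℕ :=
  [3, 5, 7, 11, 13, 17, 19, 23, 29, 31, 37, 41, 43, 47, 53, 59, 61, 67, 71, 73, 79, 83, 89,
   97, 101, 103, 107, 109, 113, 127, 131, 137, 139, 149]

/-- The odd primes up to `73`. -/
def trialDivisors : List ℕ :=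
  [3, 5, 7, 11, 13, 17, 19, 23, 29, 31, 37, 41, 43, 47, 53, 59, 61, 67, 71, 73]

/-- The odd composite numbers up to `169`. -/
def oddComposites : List ℕ :=
  [9, 15, 21, 25, 27, 33, 35, 39, 45, 49, 51, 55, 57, 63, 65, 69, 75, 77, 81, 85, 87, 91,
   93, 95, 99, 105, 111, 115, 117, 119, 121, 123, 125, 129, 133, 135, 141, 143, 145, 147,
   153, 155, 159, 161, 165, 169]

/-- Search for a prime `p` and a composite `r ≥ p` coprime to `m` such that `p + m` is prime. -/
noncomputable def directTest (m : ℕ) : Bool :=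
  force m fun m => oddPrimes.any fun p => force (p + m) fun n =>
    trialDivisors.all (fun d => n.beq d || !(n % d).beq 0) &&
    oddComposites.any fun r => p.ble r && r.blt m && (r.gcd m).beq 1 && !r.beq (m / 2 + 2)

lemma prime_of_mem_oddPrimes : ∀ p ∈ oddPrimes, p.Prime := by
  simp only [oddPrimes, List.forall_mem_cons]
  norm_num

lemma not_prime_of_mem_oddComposites : ∀ r ∈ oddComposites, ¬ r.Prime := by
  simp only [oddComposites, List.forall_mem_cons]
  norm_num

lemma mem_trialDivisors {q : ℕ} (hq : q.Prime) (h2 : q ≠ 2) (h : q < 79) : q ∈ trialDivisors := by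
  have key : ∀ q < 79, q ∈ trialDivisors ∨ q ≤ 2 ∨ ∃ d ∈ [2, 3, 5, 7], d ∣ q ∧ d < q := by
    decide +kernel
  rcases key q h with h1 | h1 | ⟨d, hd, hdq, hlt⟩
  · exact h1
  · exact absurd (hq.two_le.antisymm h1).symm h2
  · rcases (Nat.dvd_prime hq).1 hdq with rfl | rfl
    exacts [absurd hd (by decide), absurd rfl hlt.ne]

lemma prime_of_trialDivisors {n : ℕ} (hn : 2 ≤ n) (hodd : n % 2 = 1) (hlt : n < 79 ^ 2)
    (h : ∀ d ∈ trialDivisors, n = d ∨ ¬ n % d = 0) : n.Prime := by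
  by_contra hnp
  have hq := Nat.minFac_prime (n := n) (by omega)
  have hqn := Nat.minFac_dvd n
  have hsq := Nat.minFac_sq_le_self (n := n) (by omega) hnp
  set q := n.minFac
  have h2 : q ≠ 2 := fun h2 => by
    rw [h2] at hqn
    omega
  have h79 : q < 79 := lt_of_pow_lt_pow_left₀ 2 (by omega) (hsq.trans_lt hlt)
  rcases h q (mem_trialDivisors hq h2 h79) with h1 | h1
  · exact hnp (h1 ▸ hq)
  · exact h1 (Nat.mod_eq_zero_of_dvd hqn)

theorem Saturated.false_of_directTest {m T : ℕ} (h : Saturated m T) (hm : m ≤ 6000)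
    (htest : directTest m = true) : False := by
  have h2 := h.even
  simp only [directTest, force_eq, List.any_eq_true, Bool.and_eq_true, List.all_eq_true,
    Bool.or_eq_true, Bool.not_eq_true', Nat.beq_eq, Nat.ble_eq, Nat.blt_eq] at htest
  obtain ⟨p, hp, hd, r, hr, ⟨⟨hpr, hrm⟩, hc⟩, hne⟩ := htest
  have hpr := prime_of_mem_oddPrimes p hp
  have hp2 : p % 2 = 1 ∧ p ≤ 149 := by
    have : ∀ p ∈ oddPrimes, p % 2 = 1 ∧ p ≤ 149 := by decide +kernel
    exact this p hp
  refine h.false_of_prime_add hpr (prime_of_trialDivisors ?_ ?_ ?_ fun d hd' => ?_) ‹_› hrm hc ?_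
    (not_prime_of_mem_oddComposites r hr)
  · have := hpr.two_le
    omega
  · omega
  · omega
  · refine (hd d hd').imp id fun h0 h1 => ?_
    rw [h1] at h0
    exact absurd h0 (by decide)
  · rintro rfl
    rw [Nat.beq_refl] at hne
    exact absurd hne (by decide)

lemma directTest_eq_true : ∀ i < 60, ∀ j < 50, directTest (32 + 2 * (50 * i + j)) = true := by
  decide +kernel

lemma Saturated.lt_of_rangeTest {m T K₁ : ℕ} (K₂ j : ℕ) (h : Saturated m T) (hm₁ : K₁ ≤ m)
    (hm : m ≤ 2 * 10 ^ 11) (hK₁ : 30000000 ≤ K₁) (htest : rangeTest K₁ K₂ j = true) : K₂ < m := by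
  by_contra! hm₂
  exact h.false_of_rangeTest hK₁ hm₁ hm₂ hm htest

theorem Saturated.false_of_ge {m T : ℕ} (h : Saturated m T) (hm₁ : 30000000 ≤ m)
    (hm₂ : m ≤ 2 * 10 ^ 11) : False := by
  have := h.lt_of_rangeTest 37500000 1732 hm₁ hm₂ (by norm_num) (by decide +kernel)
  have := h.lt_of_rangeTest 46900000 1752 this.le hm₂ (by norm_num) (by decide +kernel)
  have := h.lt_of_rangeTest 58700000 1773 this.le hm₂ (by norm_num) (by decide +kernel)
  have := h.lt_of_rangeTest 73400000 1794 this.le hm₂ (by norm_num) (by decide +kernel)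
  have := h.lt_of_rangeTest 91800000 1814 this.le hm₂ (by norm_num) (by decide +kernel)
  have := h.lt_of_rangeTest 115000000 1835 this.le hm₂ (by norm_num) (by decide +kernel)
  have := h.lt_of_rangeTest 133000000 1849 this.le hm₂ (by norm_num) (by decide +kernel)
  have := h.lt_of_rangeTest 153000000 1862 this.le hm₂ (by norm_num) (by decide +kernel)
  have := h.lt_of_rangeTest 176000000 1875 this.le hm₂ (by norm_num) (by decide +kernel)
  have := h.lt_of_rangeTest 203000000 1888 this.le hm₂ (by norm_num) (by decide +kernel)
  have := h.lt_of_rangeTest 234000000 1901 this.le hm₂ (by norm_num) (by decide +kernel)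
  have := h.lt_of_rangeTest 270000000 1914 this.le hm₂ (by norm_num) (by decide +kernel)
  have := h.lt_of_rangeTest 311000000 1927 this.le hm₂ (by norm_num) (by decide +kernel)
  have := h.lt_of_rangeTest 358000000 1940 this.le hm₂ (by norm_num) (by decide +kernel)
  have := h.lt_of_rangeTest 412000000 1953 this.le hm₂ (by norm_num) (by decide +kernel)
  have := h.lt_of_rangeTest 474000000 1966 this.le hm₂ (by norm_num) (by decide +kernel)
  have := h.lt_of_rangeTest 546000000 1979 this.le hm₂ (by norm_num) (by decide +kernel)
  have := h.lt_of_rangeTest 628000000 1992 this.le hm₂ (by norm_num) (by decide +kernel)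
  have := h.lt_of_rangeTest 675000000 1999 this.le hm₂ (by norm_num) (by decide +kernel)
  have := h.lt_of_rangeTest 723000000 2005 this.le hm₂ (by norm_num) (by decide +kernel)
  have := h.lt_of_rangeTest 832000000 2018 this.le hm₂ (by norm_num) (by decide +kernel)
  have := h.lt_of_rangeTest 957000000 2031 this.le hm₂ (by norm_num) (by decide +kernel)
  have := h.lt_of_rangeTest 1110000000 2045 this.le hm₂ (by norm_num) (by decide +kernel)
  have := h.lt_of_rangeTest 1670000000 2082 this.le hm₂ (by norm_num) (by decide +kernel)
  have := h.lt_of_rangeTest 2510000000 2120 this.le hm₂ (by norm_num) (by decide +kernel)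
  have := h.lt_of_rangeTest 3770000000 2158 this.le hm₂ (by norm_num) (by decide +kernel)
  have := h.lt_of_rangeTest 5660000000 2195 this.le hm₂ (by norm_num) (by decide +kernel)
  have := h.lt_of_rangeTest 8490000000 2232 this.le hm₂ (by norm_num) (by decide +kernel)
  have := h.lt_of_rangeTest 12800000000 2270 this.le hm₂ (by norm_num) (by decide +kernel)
  have := h.lt_of_rangeTest 19200000000 2308 this.le hm₂ (by norm_num) (by decide +kernel)
  have := h.lt_of_rangeTest 28800000000 2345 this.le hm₂ (by norm_num) (by decide +kernel)
  have := h.lt_of_rangeTest 43200000000 2383 this.le hm₂ (by norm_num) (by decide +kernel)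
  have := h.lt_of_rangeTest 64800000000 2420 this.le hm₂ (by norm_num) (by decide +kernel)
  have := h.lt_of_rangeTest 97200000000 2458 this.le hm₂ (by norm_num) (by decide +kernel)
  have := h.lt_of_rangeTest 146000000000 2495 this.le hm₂ (by norm_num) (by decide +kernel)
  have := h.lt_of_rangeTest 200000000000 2524 this.le hm₂ (by norm_num) (by decide +kernel)
  omega

theorem Saturated.false_of_le_of_lt {m T : ℕ} (h : Saturated m T) (hm₁ : 6000 ≤ m)
    (hm₂ : m < 30000000) : False := by
  have key : ∀ j < 30, blockTest (3000 + 500000 * j) 500000 = true := by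
    intro j hj
    interval_cases j <;> decide +kernel
  obtain ⟨j, hj, h1, h2⟩ : ∃ j < 30, 2 * (3000 + 500000 * j) ≤ m ∧
      m < 2 * (3000 + 500000 * j + 500000) := by
    refine ⟨(m - 6000) / 1000000, ?_, ?_, ?_⟩ <;> grind
  exact h.false_of_blockTest (by omega) (by omega) h1 h2 (key j hj)

theorem Saturated.false_of_lt {m T : ℕ} (h : Saturated m T) (hm₁ : 32 ≤ m) (hm₂ : m < 6000) :
    False := by
  obtain ⟨n, rfl⟩ := h.even
  refine h.false_of_directTest hm₂.le ?_
  have := directTest_eq_true ((n - 16) / 50) (by omega) ((n - 16) % 50) (by omega)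
  rwa [show 32 + 2 * (50 * ((n - 16) / 50) + (n - 16) % 50) = 2 * n by omega] at this

theorem Saturated.lt_or_lt {m T : ℕ} (h : Saturated m T) : m < 32 ∨ 2 * 10 ^ 11 < m := by
  by_contra! hm
  rcases Nat.lt_or_ge m 6000 with h1 | h1
  · exact h.false_of_lt hm.1 h1
  · rcases Nat.lt_or_ge m 30000000 with h2 | h2
    · exact h.false_of_le_of_lt h1 h2
    · exact h.false_of_ge h2 hm.2

theorem no_PInteger_up_to_1e11 (k : ℕ) (h1 : 30 < k) (h2 : k ≤ 10 ^ 11) :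
    ¬ IsPInteger k := by
  intro hk
  by_cases heven : 2 ∣ k
  · have := (hk.saturated_of_even heven).lt_or_lt
    omega
  · have := (hk.saturated_of_odd heven).lt_or_lt
    omega
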